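/- arXiv:q-alg/9606018 — 3 statements merged into one kernel-verified Lean document; each statement's English description precedes it below -/
import Mathlib

section
/- Define K̄u := det Wr(φ_1, …, φ_N, u), an entire function for each entire u. If c_1, …, c_{n+1} are finitely supported distributions — i.e., linear functionals on entire functions, each of the form c(v) = Σ_{l=1}^m Σ_{j=0}^d a_{l,j}·v^{(j)}(ν_l) (finite sums, ν_l ∈ ℂ, a_{l,j} ∈ ℂ) — each satisfying c_s(K̄u) = 0 for every entire function u, then c_1, …, c_{n+1} are linearly dependent over ℂ. In other words, the space C^β of finitely supported distributions annihilating the image of K̄ has dimension at most n. -/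
open scoped BigOperators

/-- The generalized Airy operator `L₀ u = u^(r) - ∑_{k=1}^{r-2} a_k u^(k) - x·u`. -/
noncomputable def airyOp (r : ℕ) (a : ℕ → ℂ) (u : ℂ → ℂ) : ℂ → ℂ :=
  fun x => iteratedDeriv r u x
    - (∑ k ∈ Finset.Ico 1 (r - 1), a k * iteratedDeriv k u x) - x * u x

/-- The Wronskian determinant of an `m`-tuple of functions. -/
noncomputable def wrDet (m : ℕ) (g : Fin m → ℂ → ℂ) (x : ℂ) : ℂ :=
  Matrix.det (Matrix.of fun k s : Fin m => iteratedDeriv k.val (g s) x)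

/-- The bordered Wronskian determinant `det Wr(g₁, …, g_m, u)`. -/
noncomputable def wrDetB (m : ℕ) (g : Fin m → ℂ → ℂ) (u : ℂ → ℂ) (x : ℂ) : ℂ :=
  wrDet (m + 1) (Fin.snoc g u) x

/-- The family `φ_{i,j}(x) = γ_i·f_j(x+λ_i) + f_j'(x+λ_i)`, listed in a fixed order
as `φ_1, …, φ_N` with `N = r·n` (index `k` corresponds to `i = k / r`, `j = k % r`). -/
noncomputable def phiFam (r n : ℕ) (f : ℕ → ℂ → ℂ) (lam gam : ℕ → ℂ) :
    Fin (r * n) → ℂ → ℂ :=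
  fun k x => gam (k.val / r) * f (k.val % r) (x + lam (k.val / r)) +
    deriv (f (k.val % r)) (x + lam (k.val / r))

/-- The Vandermonde-type product `V = ∏_{i<j} (λ_i - λ_j)`. -/
noncomputable def vand (n : ℕ) (lam : ℕ → ℂ) : ℂ :=
  ∏ i ∈ Finset.range n, ∏ j ∈ Finset.Ico (i + 1) n, (lam i - lam j)

/-! ### Entire functions and their order of vanishing at a point -/

lemma Differentiable.iteratedDeriv_complex {f : ℂ → ℂ} (hf : Differentiable ℂ f) (k : ℕ) :
    Differentiable ℂ (iteratedDeriv k f) :=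
  (hf.contDiff (n := (k + 1 : ℕ))).differentiable_iteratedDeriv k (by exact_mod_cast k.lt_succ_self)

lemma Differentiable.deriv_complex {f : ℂ → ℂ} (hf : Differentiable ℂ f) :
    Differentiable ℂ (_root_.deriv f) := by
  simpa using hf.iteratedDeriv_complex 1

lemma Differentiable.exists_eq_sub_mul {f : ℂ → ℂ} (hf : Differentiable ℂ f) {z : ℂ}
    (hz : f z = 0) : ∃ g : ℂ → ℂ, Differentiable ℂ g ∧ ∀ x, f x = (x - z) * g x := by
  refine ⟨dslope f z, ?_, fun x => ?_⟩
  · rw [← differentiableOn_univ] at hf ⊢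
    exact (Complex.differentiableOn_dslope Filter.univ_mem).2 hf
  · simpa [hz] using (sub_smul_dslope f z x).symm

lemma Differentiable.matrix_det {ι : Type*} [Fintype ι] [DecidableEq ι] {A : ℂ → Matrix ι ι ℂ}
    (hA : ∀ i j, Differentiable ℂ fun x => A x i j) : Differentiable ℂ fun x => (A x).det := by
  simp only [Matrix.det_apply]
  fun_prop

/-- `f` is entire and vanishes to order exactly `p` at `z`. -/
def HasZeroOrder (z : ℂ) (p : ℕ) (f : ℂ → ℂ) : Prop :=
  ∃ g : ℂ → ℂ, Differentiable ℂ g ∧ g z ≠ 0 ∧ f = fun x => (x - z) ^ p * g x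

lemma HasZeroOrder.differentiable {z : ℂ} {p : ℕ} {f : ℂ → ℂ} (h : HasZeroOrder z p f) :
    Differentiable ℂ f := by
  obtain ⟨g, hg, -, rfl⟩ := h
  fun_prop

lemma le_of_pow_mul_eq_pow_mul {z : ℂ} {a b : ℕ} {F G : ℂ → ℂ} (hF : Continuous F)
    (hG : Continuous G) (hGz : G z ≠ 0)
    (h : ∀ x, (x - z) ^ a * F x = (x - z) ^ b * G x) : a ≤ b := by
  by_contra! hab
  obtain ⟨c, rfl⟩ := Nat.exists_eq_add_of_lt hab
  have key : (fun x => (x - z) ^ (c + 1) * F x) = G := by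
    refine Continuous.ext_on (dense_compl_singleton z) (by fun_prop) hG fun x hx => ?_
    have hx' : (x - z) ^ b ≠ 0 := pow_ne_zero _ (sub_ne_zero.2 hx)
    refine mul_left_cancel₀ hx' ?_
    rw [← h x]
    ring
  exact hGz (by rw [← key]; simp)

lemma eq_pow_mul_of_pow_mul_eq_pow_mul {z : ℂ} {a c : ℕ} {F G : ℂ → ℂ} (hF : Continuous F)
    (hG : Continuous G) (h : ∀ x, (x - z) ^ a * F x = (x - z) ^ (a + c) * G x) :
    F = fun x => (x - z) ^ c * G x := by
  refine Continuous.ext_on (dense_compl_singleton z) hF (by fun_prop) fun x hx => ?_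
  have hx' : (x - z) ^ a ≠ 0 := pow_ne_zero _ (sub_ne_zero.2 hx)
  refine mul_left_cancel₀ hx' ?_
  rw [h x]
  ring

/-- If `f x = (x - z) ^ e * g x`, then `(x - z) ^ k * f⁽ᵏ⁾ x = (x - z) ^ e * eulerIter z e g k x`. -/
noncomputable def eulerIter (z : ℂ) (e : ℕ) (g : ℂ → ℂ) : ℕ → ℂ → ℂ
  | 0 => g
  | k + 1 => fun x => ((e : ℂ) - k) * eulerIter z e g k x + (x - z) * deriv (eulerIter z e g k) x

lemma differentiable_eulerIter (z : ℂ) (e : ℕ) {g : ℂ → ℂ} (hg : Differentiable ℂ g) (k : ℕ) :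
    Differentiable ℂ (eulerIter z e g k) := by
  induction k with
  | zero => exact hg
  | succ k ih =>
    have := Differentiable.deriv_complex ih
    unfold eulerIter
    fun_prop

lemma eulerIter_self (z : ℂ) (e : ℕ) (g : ℂ → ℂ) (k : ℕ) :
    eulerIter z e g k z = (descPochhammer ℂ k).eval (e : ℂ) * g z := by
  induction k with
  | zero => simp [eulerIter]
  | succ k ih =>
    simp only [descPochhammer_succ_eval, eulerIter, ih]
    ring

lemma pow_mul_iteratedDeriv (z : ℂ) (e : ℕ) {g : ℂ → ℂ} (hg : Differentiable ℂ g) (k : ℕ) (x : ℂ) :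
    (x - z) ^ k * iteratedDeriv k (fun y => (y - z) ^ e * g y) x =
      (x - z) ^ e * eulerIter z e g k x := by
  have hf : Differentiable ℂ fun y => (y - z) ^ e * g y := by fun_prop
  induction k generalizing x with
  | zero => simp [eulerIter]
  | succ k ih =>
    have hD := (hf.iteratedDeriv_complex k) x
    have hE := differentiable_eulerIter z e hg k x
    have h1 : HasDerivAt (fun y => y - z) 1 x := (hasDerivAt_id x).sub_const z
    have h2 := (h1.pow k).mul hD.hasDerivAt
    have h3 := (h1.pow e).mul hE.hasDerivAt
    have h4 := h2.unique (h3.congr_of_eventuallyEq (Filter.Eventually.of_forall fun y => ih y))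
    rw [iteratedDeriv_succ, eulerIter]
    have h5 := congrArg (fun t => (x - z) * t) h4
    have ih' := ih x
    have hk : (k : ℂ) * (x - z) ^ (k - 1) * (x - z) = k * (x - z) ^ k := by
      cases k with
      | zero => simp
      | succ k => simp [pow_succ]; ring
    have he : (e : ℂ) * (x - z) ^ (e - 1) * (x - z) = e * (x - z) ^ e := by
      cases e with
      | zero => simp
      | succ e => simp [pow_succ]; ring
    simp only [Pi.pow_apply, mul_one] at h5
    linear_combination h5 - iteratedDeriv k (fun y => (y - z) ^ e * g y) x * hk +
      eulerIter z e g k x * he - k * ih'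

lemma HasZeroOrder.iteratedDeriv_ne_zero {z : ℂ} {p : ℕ} {f : ℂ → ℂ} (h : HasZeroOrder z p f) :
    iteratedDeriv p f z ≠ 0 := by
  obtain ⟨g, hg, hgz, rfl⟩ := h
  have hf : Differentiable ℂ fun y => (y - z) ^ p * g y := by fun_prop
  have h := eq_pow_mul_of_pow_mul_eq_pow_mul (c := 0) (hf.iteratedDeriv_complex p).continuous
    (differentiable_eulerIter z p hg p).continuous (pow_mul_iteratedDeriv z p hg p)
  rw [h]
  simp [eulerIter_self, hgz, descPochhammer_eval_eq_descFactorial, Nat.descFactorial_self,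
    Nat.factorial_ne_zero]

lemma iteratedDeriv_pow_mul_eq_zero {z : ℂ} {p q : ℕ} (hq : q < p) {g : ℂ → ℂ}
    (hg : Differentiable ℂ g) : iteratedDeriv q (fun y => (y - z) ^ p * g y) z = 0 := by
  have hf : Differentiable ℂ fun y => (y - z) ^ p * g y := by fun_prop
  obtain ⟨c, rfl⟩ := Nat.exists_eq_add_of_lt hq
  have h := eq_pow_mul_of_pow_mul_eq_pow_mul (c := c + 1) (hf.iteratedDeriv_complex q).continuous
    (differentiable_eulerIter z _ hg q).continuous (pow_mul_iteratedDeriv z _ hg q)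
  rw [h]
  simp

lemma exists_hasZeroOrder {f : ℂ → ℂ} (hf : Differentiable ℂ f) (hf0 : f ≠ 0) (z : ℂ) :
    ∃ p, HasZeroOrder z p f := by
  have hex : ∃ q, iteratedDeriv q f z ≠ 0 := by
    by_contra! hcon
    refine hf0 (funext fun x => ?_)
    rw [← Complex.taylorSeries_eq_of_entire hf z x]
    simp [hcon]
  have main : ∀ p : ℕ, (∀ q < p, iteratedDeriv q f z = 0) →
      ∃ g : ℂ → ℂ, Differentiable ℂ g ∧ f = fun x => (x - z) ^ p * g x := by
    intro p
    induction p with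
    | zero => exact fun _ => ⟨f, hf, by simp⟩
    | succ p ih =>
      intro h
      obtain ⟨g, hg, hfg⟩ := ih fun q hq => h q (by omega)
      have hgz : g z = 0 := by
        by_contra hgz
        exact HasZeroOrder.iteratedDeriv_ne_zero ⟨g, hg, hgz, hfg⟩ (h p p.lt_succ_self)
      obtain ⟨g', hg', hgg'⟩ := hg.exists_eq_sub_mul hgz
      exact ⟨g', hg', by simp only [hfg, hgg', pow_succ, mul_assoc]⟩
  classical
  obtain ⟨g, hg, hfg⟩ := main (Nat.find hex) fun q hq => by simpa using Nat.find_min hex hq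
  refine ⟨Nat.find hex, g, hg, fun hgz => Nat.find_spec hex ?_, hfg⟩
  obtain ⟨g', hg', hgg'⟩ := hg.exists_eq_sub_mul hgz
  have hfg' : f = fun x => (x - z) ^ (Nat.find hex + 1) * g' x :=
    hfg.trans (by simp only [hgg', pow_succ, mul_assoc])
  generalize Nat.find hex = p at hfg'
  rw [hfg']
  exact iteratedDeriv_pow_mul_eq_zero p.lt_succ_self hg'

lemma HasZeroOrder.ne_zero {z : ℂ} {p : ℕ} {f : ℂ → ℂ} (h : HasZeroOrder z p f) : f ≠ 0 := by
  rintro rfl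
  refine h.iteratedDeriv_ne_zero ?_
  simp

lemma HasZeroOrder.unique {z : ℂ} {p q : ℕ} {f : ℂ → ℂ} (hp : HasZeroOrder z p f)
    (hq : HasZeroOrder z q f) : p = q := by
  obtain ⟨g, hg, hgz, hfg⟩ := hp
  obtain ⟨g', hg', hgz', hfg'⟩ := hq
  rw [hfg] at hfg'
  have h := congrFun hfg'
  exact le_antisymm (le_of_pow_mul_eq_pow_mul hg.continuous hg'.continuous hgz' h)
    (le_of_pow_mul_eq_pow_mul hg'.continuous hg.continuous hgz fun x => (h x).symm)

/-! ### Orders of vanishing of Wronskians -/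

lemma differentiable_wrDet {m : ℕ} {g : Fin m → ℂ → ℂ} (hg : ∀ i, Differentiable ℂ (g i)) :
    Differentiable ℂ (wrDet m g) := by
  refine Differentiable.matrix_det fun i j => ?_
  exact (hg j).iteratedDeriv_complex i

/-- Functions with pairwise distinct orders of vanishing at `z` have a Wronskian of order
`∑ e i - m (m - 1) / 2` at `z`. -/
lemma exists_hasZeroOrder_wrDet {m : ℕ} {z : ℂ} {e : Fin m → ℕ} (he : Function.Injective e)
    {g : Fin m → ℂ → ℂ} (hg : ∀ i, HasZeroOrder z (e i) (g i)) :
    ∃ k, k + ∑ i : Fin m, (i : ℕ) = ∑ i, e i ∧ HasZeroOrder z k (wrDet m g) := by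
  choose q hq hqz hgq using hg
  set H : ℂ → ℂ := fun x => Matrix.det (Matrix.of fun k i : Fin m => eulerIter z (e i) (q i) k x)
  have hH : Differentiable ℂ H :=
    Differentiable.matrix_det fun k i => differentiable_eulerIter z (e i) (hq i) k
  have hHz : H z ≠ 0 := by
    have h1 : H z = (∏ i, q i z) *
        Matrix.det (Matrix.of fun i k : Fin m => (descPochhammer ℂ k).eval (e i : ℂ)) := by
      rw [← Matrix.det_transpose, ← Matrix.det_mul_row]
      refine congrArg Matrix.det ?_
      ext k i
      simp [eulerIter_self, mul_comm]
    rw [h1, ← Matrix.det_eval_matrixOfPolynomials_eq_det_vandermonde _ _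
      (fun i => descPochhammer_natDegree ℂ i) (fun i => monic_descPochhammer ℂ i)]
    refine mul_ne_zero (Finset.prod_ne_zero_iff.2 fun i _ => hqz i)
      (Matrix.det_vandermonde_ne_zero_iff.2 fun i j hij => he (by exact_mod_cast hij))
  have hW : Differentiable ℂ (wrDet m g) := differentiable_wrDet fun i => by
    rw [hgq i]
    have := hq i
    fun_prop
  have key : ∀ x, (x - z) ^ (∑ i : Fin m, (i : ℕ)) * wrDet m g x = (x - z) ^ (∑ i, e i) * H x := by
    intro x
    simp only [H, wrDet, ← Finset.prod_pow_eq_pow_sum]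
    rw [← Matrix.det_mul_column, ← Matrix.det_mul_row]
    refine congrArg Matrix.det ?_
    ext k i
    simp only [Matrix.of_apply]
    rw [hgq i]
    exact pow_mul_iteratedDeriv z (e i) (hq i) k x
  have hle := le_of_pow_mul_eq_pow_mul hW.continuous hH.continuous hHz key
  obtain ⟨k, hk⟩ := Nat.exists_eq_add_of_le hle
  refine ⟨k, by omega, H, hH, hHz, ?_⟩
  rw [hk] at key
  exact eq_pow_mul_of_pow_mul_eq_pow_mul hW.continuous hH.continuous key

lemma iteratedDeriv_sum_smul {ι : Type*} (s : Finset ι) {g : ι → ℂ → ℂ}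
    (hg : ∀ i, Differentiable ℂ (g i)) (c : ι → ℂ) (k : ℕ) :
    iteratedDeriv k (∑ i ∈ s, c i • g i) = ∑ i ∈ s, c i • iteratedDeriv k (g i) := by
  induction k with
  | zero => simp
  | succ k ih =>
    funext x
    rw [iteratedDeriv_succ, ih, deriv_sum fun i _ => ((hg i).iteratedDeriv_complex k x).const_smul _,
      Finset.sum_apply]
    refine Finset.sum_congr rfl fun i _ => ?_
    rw [deriv_const_smul _ ((hg i).iteratedDeriv_complex k x), iteratedDeriv_succ, Pi.smul_apply]

lemma wrDet_sum_smul {m : ℕ} {g : Fin m → ℂ → ℂ} (hg : ∀ i, Differentiable ℂ (g i))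
    (G : Matrix (Fin m) (Fin m) ℂ) (x : ℂ) :
    wrDet m (fun i => ∑ j, G j i • g j) x = wrDet m g x * G.det := by
  rw [wrDet, wrDet, ← Matrix.det_mul]
  refine congrArg Matrix.det ?_
  ext k i
  simp [iteratedDeriv_sum_smul _ hg, Matrix.mul_apply, mul_comm]

lemma hasZeroOrder_of_mul_const {z c : ℂ} {p : ℕ} {f : ℂ → ℂ}
    (h : HasZeroOrder z p fun x => f x * c) : HasZeroOrder z p f := by
  obtain ⟨g, hg, hgz, hfg⟩ := h
  have hc : c ≠ 0 := by
    rintro rfl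
    have h0 := HasZeroOrder.ne_zero ⟨g, hg, hgz, hfg⟩
    exact h0 (by simp; rfl)
  refine ⟨fun x => g x * c⁻¹, by fun_prop, mul_ne_zero hgz (inv_ne_zero hc), funext fun x => ?_⟩
  have := congrFun hfg x
  field_simp
  exact this

lemma exists_injective_hasZeroOrder {N : ℕ} {φ : Fin N → ℂ → ℂ}
    (hφ : ∀ i, Differentiable ℂ (φ i)) (hind : LinearIndependent ℂ φ) (z : ℂ) :
    ∃ (e : Fin N → ℕ) (G : Matrix (Fin N) (Fin N) ℂ), Function.Injective e ∧
      ∀ i, HasZeroOrder z (e i) (∑ j, G j i • φ j) := by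
  set F : Set ℕ := {p | ∃ c : Fin N → ℂ, HasZeroOrder z p (∑ j, c j • φ j)}
  have hF : ∃ t : Finset ℕ, (t : Set ℕ) ⊆ F ∧ t.card = N := by
    by_cases hfin : F.Finite
    · suffices h : N ≤ hfin.toFinset.card by
        obtain ⟨t, ht, htN⟩ := Finset.exists_subset_card_eq h
        exact ⟨t, fun p hp => hfin.mem_toFinset.1 (ht hp), htN⟩
      by_contra! hlt
      let T : (Fin N → ℂ) →ₗ[ℂ] (hfin.toFinset → ℂ) :=
        Matrix.mulVecLin (Matrix.of fun p j => iteratedDeriv p (φ j) z)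
      have hker : LinearMap.ker T ≠ ⊥ := LinearMap.ker_ne_bot_of_finrank_lt (by simpa using hlt)
      obtain ⟨c, hc, hc0⟩ := (Submodule.ne_bot_iff _).1 hker
      have hv : (∑ j, c j • φ j) ≠ 0 := fun h =>
        hc0 (funext (Fintype.linearIndependent_iff.1 hind c h))
      have hd : Differentiable ℂ (∑ j, c j • φ j) := by fun_prop
      obtain ⟨p, hp⟩ := exists_hasZeroOrder hd hv z
      refine hp.iteratedDeriv_ne_zero ?_
      have := congrFun (LinearMap.mem_ker.1 hc) ⟨p, hfin.mem_toFinset.2 ⟨c, hp⟩⟩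
      simpa [iteratedDeriv_sum_smul _ hφ, T, Matrix.mulVec, dotProduct, mul_comm] using this
    · obtain ⟨t, ht, htN⟩ := Set.Infinite.exists_subset_card_eq hfin N
      exact ⟨t, ht, htN⟩
  obtain ⟨t, htF, htN⟩ := hF
  have hmem : ∀ i, t.orderEmbOfFin htN i ∈ F := fun i => htF (t.orderEmbOfFin_mem htN i)
  choose c hc using hmem
  exact ⟨t.orderEmbOfFin htN, Matrix.of fun j i => c i j, (t.orderEmbOfFin htN).injective, hc⟩

/-- If `φ` is a linearly independent family of entire functions whose Wronskian has order `k` at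
`z`, then all orders below `M`, except for at most `k` of them, are attained at `z` by bordered
Wronskians of `φ`. -/
lemma exists_orders_wrDetB {N : ℕ} {φ : Fin N → ℂ → ℂ} (hφ : ∀ i, Differentiable ℂ (φ i))
    (hind : LinearIndependent ℂ φ) (z : ℂ) :
    ∃ k, HasZeroOrder z k (wrDet N φ) ∧ ∀ M : ℕ, ∃ S : Finset ℕ, S.card ≤ k ∧
      ∀ p < M, p ∉ S → ∃ q, ∀ u, HasZeroOrder z q u → HasZeroOrder z p (wrDetB N φ u) := by
  obtain ⟨e, G, he, hG⟩ := exists_injective_hasZeroOrder hφ hind z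
  obtain ⟨k, hk, hk'⟩ := exists_hasZeroOrder_wrDet he hG
  have hwr : HasZeroOrder z k (wrDet N φ) := by
    rw [funext fun x => wrDet_sum_smul hφ G x] at hk'
    exact hasZeroOrder_of_mul_const hk'
  have hB : ∀ q, (∀ i, e i ≠ q) → ∃ p, p + N = k + q ∧
      ∀ u, HasZeroOrder z q u → HasZeroOrder z p (wrDetB N φ u) := by
    intro q hq
    have hu : ∀ u, HasZeroOrder z q u → ∃ p, p + N = k + q ∧ HasZeroOrder z p (wrDetB N φ u) := by
      intro u hu
      have hinj : Function.Injective (Fin.snoc e q : Fin (N + 1) → ℕ) :=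
        Fin.snoc_injective_iff.2 ⟨he, by simpa using hq⟩
      have hord : ∀ i, HasZeroOrder z ((Fin.snoc e q : Fin (N + 1) → ℕ) i)
          ((Fin.snoc (fun i => ∑ j, G j i • φ j) u : Fin (N + 1) → ℂ → ℂ) i) := by
        intro i
        refine Fin.lastCases ?_ (fun i => ?_) i
        · simpa using hu
        · simpa using hG i
      obtain ⟨p, hp, hp'⟩ := exists_hasZeroOrder_wrDet hinj hord
      refine ⟨p, ?_, ?_⟩
      · rw [Fin.sum_univ_castSucc, Fin.sum_univ_castSucc] at hp
        simp at hp
        omega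
      · let G' : Matrix (Fin (N + 1)) (Fin (N + 1)) ℂ := Matrix.of fun j i =>
          Fin.lastCases (if j = Fin.last N then 1 else 0)
            (fun i => Fin.lastCases 0 (fun j => G j i) j) i
        have hsnoc : (Fin.snoc (fun i => ∑ j, G j i • φ j) u : Fin (N + 1) → ℂ → ℂ) =
            fun i => ∑ j, G' j i • (Fin.snoc φ u : Fin (N + 1) → ℂ → ℂ) j := by
          funext i
          rw [Fin.sum_univ_castSucc]
          refine Fin.lastCases ?_ (fun i => ?_) i
          · simp [G', Fin.castSucc_ne_last]
          · simp [G']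
        have hdiff : ∀ i, Differentiable ℂ ((Fin.snoc φ u : Fin (N + 1) → ℂ → ℂ) i) := by
          intro i
          refine Fin.lastCases ?_ (fun i => ?_) i
          · simpa using hu.differentiable
          · simpa using hφ i
        rw [hsnoc, funext fun x => wrDet_sum_smul hdiff G' x] at hp'
        exact hasZeroOrder_of_mul_const hp'
    obtain ⟨p, hp, -⟩ := hu (fun x => (x - z) ^ q * 1) ⟨1, by fun_prop, by simp, rfl⟩
    refine ⟨p, hp, fun u h => ?_⟩
    obtain ⟨p', hp', h'⟩ := hu u h
    obtain rfl : p = p' := by omega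
    exact h'
  refine ⟨k, hwr, fun M => ?_⟩
  set Q : Finset ℕ := Finset.range (M + N - k) \ Finset.univ.image e
  have hQ : ∀ q ∈ Q, ∀ i, e i ≠ q := by
    intro q hq i hi
    simp only [Q, Finset.mem_sdiff, Finset.mem_image, Finset.mem_univ, true_and] at hq
    exact hq.2 ⟨i, hi⟩
  have hinj : Set.InjOn (fun q => k + q - N) (Q : Set ℕ) := by
    intro q hq q' hq' h
    obtain ⟨p, hp, -⟩ := hB q (hQ q hq)
    obtain ⟨p', hp', -⟩ := hB q' (hQ q' hq')
    simp only at h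
    omega
  have hsub : Q.image (fun q => k + q - N) ⊆ Finset.range M := by
    intro p hp
    obtain ⟨q, hq, rfl⟩ := Finset.mem_image.1 hp
    obtain ⟨p, hp, -⟩ := hB q (hQ q hq)
    simp only [Q, Finset.mem_sdiff, Finset.mem_range] at hq ⊢
    omega
  refine ⟨Finset.range M \ Q.image (fun q => k + q - N), ?_, fun p hpM hp => ?_⟩
  · have h1 : M + N - k ≤ Q.card + N := by
      have := Finset.le_card_sdiff (Finset.univ.image e) (Finset.range (M + N - k))
      have h2 : (Finset.univ.image e).card = N := by
        rw [Finset.card_image_of_injective _ he, Finset.card_fin]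
      rw [h2, Finset.card_range] at this
      change _ ≤ Q.card at this
      omega
    rw [Finset.card_sdiff_of_subset hsub, Finset.card_image_of_injOn hinj, Finset.card_range]
    omega
  · have hp' : p ∈ Q.image (fun q => k + q - N) := by
      by_contra h
      exact hp (Finset.mem_sdiff.2 ⟨Finset.mem_range.2 hpM, h⟩)
    obtain ⟨q, hq, rfl⟩ := Finset.mem_image.1 hp'
    obtain ⟨p, hp, h⟩ := hB q (hQ q hq)
    obtain rfl : p = k + q - N := by omega
    exact ⟨q, h⟩

/-! ### Counting annihilating distributions -/

lemma iteratedDeriv_wrDetB_pow_mul_eq_zero {N : ℕ} {φ : Fin N → ℂ → ℂ}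
    (hφ : ∀ i, Differentiable ℂ (φ i)) {z : ℂ} {M p : ℕ} (hp : p < M) {g : ℂ → ℂ}
    (hg : Differentiable ℂ g) :
    iteratedDeriv p (wrDetB N φ fun x => (x - z) ^ (M + N) * g x) z = 0 := by
  set u : ℂ → ℂ := fun x => (x - z) ^ (M + N) * g x
  have hu : Differentiable ℂ u := by fun_prop
  have hder : ∀ k : Fin (N + 1), ∃ h : ℂ → ℂ, Differentiable ℂ h ∧
      ∀ x, iteratedDeriv k u x = (x - z) ^ M * h x := by
    intro k
    obtain ⟨j, hj⟩ := Nat.exists_eq_add_of_le (Nat.lt_succ_iff.1 k.isLt)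
    have hE := differentiable_eulerIter z (M + N) hg k
    refine ⟨fun x => (x - z) ^ j * eulerIter z (M + N) g k x, by fun_prop, fun x => ?_⟩
    have hexp : (k : ℕ) + (M + j) = M + N := by omega
    have := eq_pow_mul_of_pow_mul_eq_pow_mul (c := M + j) (hu.iteratedDeriv_complex k).continuous
      hE.continuous (fun x => by rw [hexp]; exact pow_mul_iteratedDeriv z (M + N) hg k x)
    rw [this]
    ring
  choose h hh hhu using hder
  set H : ℂ → ℂ := fun x => Matrix.det (Matrix.of fun k s : Fin (N + 1) =>
    (Fin.lastCases (h k x) (fun s => iteratedDeriv k (φ s) x) s : ℂ))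
  have hH : Differentiable ℂ H := by
    refine Differentiable.matrix_det fun k s => ?_
    refine Fin.lastCases ?_ (fun s => ?_) s
    · simpa using hh k
    · simpa using (hφ s).iteratedDeriv_complex k
  have key : wrDetB N φ u = fun x => (x - z) ^ M * H x := by
    funext x
    have hprod : (x - z) ^ M =
        ∏ s : Fin (N + 1), (Fin.lastCases ((x - z) ^ M) (fun _ => 1) s : ℂ) := by
      simp [Fin.prod_univ_castSucc]
    rw [hprod]
    simp only [H]
    rw [← Matrix.det_mul_row, wrDetB, wrDet]
    refine congrArg Matrix.det ?_
    ext k s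
    refine Fin.lastCases ?_ (fun s => ?_) s
    · simpa using hhu k x
    · simp
  rw [key]
  exact iteratedDeriv_pow_mul_eq_zero hp hH

lemma Polynomial.sum_rootMultiplicity_le (P : Polynomial ℂ) (S : Finset ℂ) :
    ∑ z ∈ S, P.rootMultiplicity z ≤ P.natDegree := by
  classical
  calc ∑ z ∈ S, P.rootMultiplicity z ≤ ∑ z ∈ S ∪ P.roots.toFinset, P.roots.count z := by
        simp only [Polynomial.count_roots]
        exact Finset.sum_le_sum_of_subset Finset.subset_union_left
    _ = P.roots.card := Multiset.sum_count_eq_card fun z hz => by simp [hz]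
    _ ≤ P.natDegree := P.card_roots'

lemma Polynomial.hasZeroOrder_eval {P : Polynomial ℂ} (hP : P ≠ 0) (z : ℂ) :
    HasZeroOrder z (P.rootMultiplicity z) fun x => P.eval x := by
  obtain ⟨R, hR, hdvd⟩ := P.exists_eq_pow_rootMultiplicity_mul_and_not_dvd hP z
  refine ⟨fun x => R.eval x, R.differentiable, fun h => hdvd (Polynomial.dvd_iff_isRoot.2 h), ?_⟩
  funext x
  conv_lhs => rw [hR]
  simp

/-- If a linearly independent family of entire functions has a polynomial Wronskian of degree at
most `n`, then any `n + 1` finitely supported distributions annihilating all its bordered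
Wronskians are linearly dependent. -/
theorem exists_relation_of_annihilates {N n : ℕ} {φ : Fin N → ℂ → ℂ}
    (hφ : ∀ i, Differentiable ℂ (φ i)) (hind : LinearIndependent ℂ φ) {P : Polynomial ℂ}
    (hP : ∀ x, wrDet N φ x = P.eval x) (hdeg : P.natDegree ≤ n)
    (m d : ℕ → ℕ) (nu : ℕ → ℕ → ℂ) (A : ℕ → ℕ → ℕ → ℂ)
    (hann : ∀ s < n + 1, ∀ u : ℂ → ℂ, Differentiable ℂ u →
      ∑ l ∈ Finset.range (m s), ∑ j ∈ Finset.range (d s + 1),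
        A s l j * iteratedDeriv j (wrDetB N φ u) (nu s l) = 0) :
    ∃ β : ℕ → ℂ, (∃ s < n + 1, β s ≠ 0) ∧ ∀ v : ℂ → ℂ,
      ∑ s ∈ Finset.range (n + 1), β s *
        (∑ l ∈ Finset.range (m s), ∑ j ∈ Finset.range (d s + 1),
          A s l j * iteratedDeriv j v (nu s l)) = 0 := by
  classical
  choose k hk hexc using exists_orders_wrDetB hφ hind
  set S : Finset ℂ := (Finset.range (n + 1)).biUnion fun s => (Finset.range (m s)).image (nu s)
    with hS
  set M : ℕ := (Finset.range (n + 1)).sup d + 1 with hM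
  choose E hEk hE using fun z => hexc z M
  set b : ℕ → ℂ → ℕ → ℂ := fun s z p =>
    ∑ l ∈ Finset.range (m s), if nu s l = z ∧ p < d s + 1 then A s l p else 0 with hb
  have hcanon : ∀ s < n + 1, ∀ v : ℂ → ℂ,
      ∑ l ∈ Finset.range (m s), ∑ j ∈ Finset.range (d s + 1), A s l j * iteratedDeriv j v (nu s l) =
        ∑ z ∈ S, ∑ p ∈ Finset.range M, b s z p * iteratedDeriv p v z := by
    intro s hs v
    simp only [hb, Finset.sum_mul]
    refine Eq.symm ((Finset.sum_congr rfl fun z _ => Finset.sum_comm).trans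
      (Finset.sum_comm.trans (Finset.sum_congr rfl fun l hl => Eq.symm ?_)))
    have hmem : nu s l ∈ S :=
      Finset.mem_biUnion.2 ⟨s, Finset.mem_range.2 hs, Finset.mem_image_of_mem _ hl⟩
    rw [Finset.sum_eq_single_of_mem _ hmem fun z _ hz =>
      Finset.sum_eq_zero fun p _ => by simp [hz.symm]]
    have hd : d s + 1 ≤ M := Nat.succ_le_succ (Finset.le_sup (Finset.mem_range.2 hs))
    rw [← Finset.sum_subset (Finset.range_mono hd)]
    · refine Finset.sum_congr rfl fun p hp => ?_
      rw [if_pos ⟨rfl, Finset.mem_range.1 hp⟩]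
    · intro p _ hp
      rw [if_neg fun h => hp (Finset.mem_range.2 h.2), zero_mul]
  set T : Finset (Σ _ : ℂ, ℕ) := S.sigma E
  have hP0 : P ≠ 0 := by
    rintro rfl
    exact (hk 0).ne_zero (funext fun x => by simp [hP])
  have hT : T.card ≤ n := by
    have hkP : ∀ z, k z = P.rootMultiplicity z := fun z =>
      (hk z).unique (funext hP ▸ P.hasZeroOrder_eval hP0 z)
    calc T.card = ∑ z ∈ S, (E z).card := Finset.card_sigma _ _
      _ ≤ ∑ z ∈ S, P.rootMultiplicity z := Finset.sum_le_sum fun z _ => (hkP z) ▸ hEk z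
      _ ≤ n := (P.sum_rootMultiplicity_le S).trans hdeg
  let Φ : (Fin (n + 1) → ℂ) →ₗ[ℂ] (T → ℂ) :=
    Matrix.mulVecLin (Matrix.of fun t s => b s t.1.1 t.1.2)
  have hker : LinearMap.ker Φ ≠ ⊥ := LinearMap.ker_ne_bot_of_finrank_lt (by simp; omega)
  obtain ⟨c, hc, hc0⟩ := (Submodule.ne_bot_iff _).1 hker
  set β : ℕ → ℂ := fun s => if h : s < n + 1 then c ⟨s, h⟩ else 0
  have hβ : ∀ s : Fin (n + 1), β s = c s := fun s => dif_pos s.isLt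
  set B : ℂ → ℕ → ℂ := fun z p => ∑ s ∈ Finset.range (n + 1), β s * b s z p with hB
  have hsum : ∀ v : ℂ → ℂ, ∑ s ∈ Finset.range (n + 1), β s *
      (∑ l ∈ Finset.range (m s), ∑ j ∈ Finset.range (d s + 1),
        A s l j * iteratedDeriv j v (nu s l)) =
      ∑ z ∈ S, ∑ p ∈ Finset.range M, B z p * iteratedDeriv p v z := by
    intro v
    rw [Finset.sum_congr rfl fun s hs => by rw [hcanon s (Finset.mem_range.1 hs) v]]
    simp only [hB, Finset.sum_mul, Finset.mul_sum]
    rw [Finset.sum_comm]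
    refine Finset.sum_congr rfl fun z _ => ?_
    rw [Finset.sum_comm]
    simp only [mul_assoc]
  have hBE : ∀ z ∈ S, ∀ p ∈ E z, B z p = 0 := by
    intro z hz p hp
    have := congrFun (LinearMap.mem_ker.1 hc) ⟨⟨z, p⟩, Finset.mem_sigma.2 ⟨hz, hp⟩⟩
    simp only [hB]
    rw [Finset.sum_range]
    simpa [Φ, Matrix.mulVec, dotProduct, hβ, mul_comm] using this
  have hBann : ∀ u : ℂ → ℂ, Differentiable ℂ u →
      ∑ z ∈ S, ∑ p ∈ Finset.range M, B z p * iteratedDeriv p (wrDetB N φ u) z = 0 := by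
    intro u hu
    rw [← hsum]
    exact Finset.sum_eq_zero fun s hs => by rw [hann s (Finset.mem_range.1 hs) u hu, mul_zero]
  have hB0 : ∀ z ∈ S, ∀ p ∈ Finset.range M, B z p = 0 := by
    intro z hz
    by_contra! hne
    have hne' : ((Finset.range M).filter fun p => B z p ≠ 0).Nonempty := by
      obtain ⟨p, hp⟩ := hne
      exact ⟨p, Finset.mem_filter.2 hp⟩
    obtain ⟨J, hJ, hJmax⟩ := Finset.exists_max_image _ id hne'
    obtain ⟨hJM, hJ0⟩ := Finset.mem_filter.1 hJ
    obtain ⟨q, hq⟩ := hE z J (Finset.mem_range.1 hJM) fun h => hJ0 (hBE z hz J h)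
    set g : ℂ → ℂ := fun x => ∏ w ∈ S.erase z, (x - w) ^ (M + N)
    have hg : Differentiable ℂ g := by fun_prop
    have hgz : g z ≠ 0 := Finset.prod_ne_zero_iff.2 fun w hw =>
      pow_ne_zero _ (sub_ne_zero.2 (Finset.ne_of_mem_erase hw).symm)
    have hord : HasZeroOrder z q fun x => (x - z) ^ q * g x := ⟨g, hg, hgz, rfl⟩
    have h0 := hBann _ hord.differentiable
    rw [Finset.sum_eq_single_of_mem z hz, Finset.sum_eq_single_of_mem J hJM] at h0
    · exact mul_ne_zero hJ0 (hq _ hord).iteratedDeriv_ne_zero h0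
    · intro p hp hpJ
      rcases lt_or_gt_of_ne hpJ with h | h
      · obtain ⟨H, hH, -, hHeq⟩ := hq _ hord
        rw [hHeq, iteratedDeriv_pow_mul_eq_zero h hH, mul_zero]
      · have : B z p = 0 := by
          by_contra hBp
          exact absurd (hJmax p (Finset.mem_filter.2 ⟨hp, hBp⟩)) (not_le.2 h)
        rw [this, zero_mul]
    · intro w hw hwz
      refine Finset.sum_eq_zero fun p hp => ?_
      have hfac : (fun x => (x - z) ^ q * g x) = fun x => (x - w) ^ (M + N) *
          ((x - z) ^ q * ∏ w' ∈ (S.erase z).erase w, (x - w') ^ (M + N)) := by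
        funext x
        simp only [g]
        rw [← Finset.mul_prod_erase _ _ (Finset.mem_erase.2 ⟨hwz, hw⟩)]
        ring
      rw [hfac, iteratedDeriv_wrDetB_pow_mul_eq_zero hφ (Finset.mem_range.1 hp) (by fun_prop),
        mul_zero]
  refine ⟨β, ?_, fun v => ?_⟩
  · obtain ⟨s, hs⟩ := Function.ne_iff.1 hc0
    exact ⟨s, s.isLt, by simpa [hβ] using hs⟩
  · rw [hsum]
    exact Finset.sum_eq_zero fun z hz => Finset.sum_eq_zero fun p hp => by
      rw [hB0 z hz p hp, zero_mul]

/-! ### Differential operators on entire functions -/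

/-- The space of entire functions. -/
def entire : Submodule ℂ (ℂ → ℂ) where
  carrier := {u | Differentiable ℂ u}
  add_mem' := Differentiable.add
  zero_mem' := differentiable_const 0
  smul_mem' c _ hu := Differentiable.const_smul hu c

namespace entire

noncomputable instance : AddCommGroup entire := inferInstance

/-- Differentiation. -/
noncomputable def D : Module.End ℂ entire where
  toFun u := ⟨deriv u, Differentiable.deriv_complex u.2⟩
  map_add' u v := Subtype.ext (funext fun x => deriv_add (u.2 x) (v.2 x))
  map_smul' c u := Subtype.ext (funext fun x => deriv_const_smul c (u.2 x))

/-- Multiplication by the coordinate function. -/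
noncomputable def X : Module.End ℂ entire where
  toFun u := ⟨fun x => x * u.1 x, differentiable_id.mul u.2⟩
  map_add' u v := Subtype.ext (funext fun x => mul_add x (u.1 x) (v.1 x))
  map_smul' c u := Subtype.ext (funext fun x => mul_left_comm x c (u.1 x))

lemma D_pow_apply (k : ℕ) (u : entire) : ((D ^ k) u : ℂ → ℂ) = iteratedDeriv k u := by
  induction k with
  | zero => simp
  | succ k ih => rw [pow_succ', Module.End.mul_apply, iteratedDeriv_succ, ← ih]; rfl

lemma D_mul_X : D * X = X * D + 1 := by
  ext u x
  have h : HasDerivAt (fun y => y * u.1 y) (1 * u.1 x + x * deriv u.1 x) x :=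
    (hasDerivAt_id x).mul (u.2 x).hasDerivAt
  refine h.deriv.trans ?_
  rw [one_mul, add_comm]
  rfl

/-- The generalized Airy operator as an endomorphism of the space of entire functions. -/
noncomputable def airy (r : ℕ) (a : ℕ → ℂ) : Module.End ℂ entire :=
  D ^ r - ∑ k ∈ Finset.Ico 1 (r - 1), a k • D ^ k - X

lemma airy_apply (r : ℕ) (a : ℕ → ℂ) (u : entire) : (airy r a u : ℂ → ℂ) = airyOp r a u := by
  funext x
  simp only [airy, airyOp, LinearMap.sub_apply, LinearMap.sum_apply, LinearMap.smul_apply,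
    Submodule.coe_sub, Submodule.coe_sum, Submodule.coe_smul, D_pow_apply, Pi.sub_apply,
    Finset.sum_apply, Pi.smul_apply, smul_eq_mul]
  rfl

lemma airy_mul_D (r : ℕ) (a : ℕ → ℂ) : airy r a * D = D * airy r a + 1 := by
  have h : (∑ k ∈ Finset.Ico 1 (r - 1), a k • D ^ k) * D =
      D * ∑ k ∈ Finset.Ico 1 (r - 1), a k • D ^ k := by
    rw [Finset.sum_mul, Finset.mul_sum]
    refine Finset.sum_congr rfl fun k _ => ?_
    rw [smul_mul_assoc, mul_smul_comm, ← pow_succ, ← pow_succ']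
  rw [airy, sub_mul, sub_mul, h, mul_sub, mul_sub, D_mul_X, ← pow_succ, ← pow_succ']
  abel

lemma airy_mul_aeval_D (r : ℕ) (a : ℕ → ℂ) (B : Polynomial ℂ) :
    airy r a * Polynomial.aeval D B =
      Polynomial.aeval D B * airy r a + Polynomial.aeval D B.derivative := by
  induction B using Polynomial.induction_on' with
  | add p q hp hq =>
    simp only [map_add, mul_add, add_mul, hp, hq]
    abel
  | monomial k c =>
    rw [← Polynomial.C_mul_X_pow_eq_monomial]
    have h : ∀ k : ℕ, airy r a * D ^ k = D ^ k * airy r a + (k : ℂ) • D ^ (k - 1) := by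
      intro k
      induction k with
      | zero => simp
      | succ k ih =>
        rw [pow_succ, ← mul_assoc, ih, add_mul, mul_assoc, airy_mul_D, mul_add, mul_one,
          smul_mul_assoc]
        have hk : (k : ℂ) • (D ^ (k - 1) * D) = (k : ℂ) • D ^ k := by
          cases k with
          | zero => simp
          | succ k => rw [Nat.add_sub_cancel, ← pow_succ]
        rw [hk, Nat.add_sub_cancel, ← mul_assoc]
        push_cast
        module
    have hC : Polynomial.aeval D (Polynomial.C c) = c • (1 : Module.End ℂ entire) := by
      rw [Polynomial.aeval_C, Algebra.algebraMap_eq_smul_one]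
    simp only [Polynomial.derivative_C_mul_X_pow, map_mul, map_pow, Polynomial.aeval_X, hC,
      smul_mul_assoc, one_mul, mul_smul_comm, h, smul_add, smul_smul, Polynomial.aeval_C,
      Algebra.algebraMap_eq_smul_one]
    simp [mul_smul, smul_comm c (k : ℂ)]

/-- Differential operators of order less than `k` with entire coefficients. -/
def orderLT (k : ℕ) : Submodule ℂ (Module.End ℂ entire) where
  carrier := {P | ∃ c : ℕ → ℂ → ℂ, (∀ t, Differentiable ℂ (c t)) ∧
    ∀ (u : entire) (x : ℂ), (P u).1 x = ∑ t ∈ Finset.range k, c t x * iteratedDeriv t u x}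
  add_mem' := by
    rintro P Q ⟨c, hc, hP⟩ ⟨c', hc', hQ⟩
    refine ⟨fun t => c t + c' t, fun t => (hc t).add (hc' t), fun u x => ?_⟩
    simp only [Pi.add_apply, add_mul, Finset.sum_add_distrib, ← hP, ← hQ]
    rfl
  zero_mem' := ⟨0, fun t => differentiable_const 0, fun u x => by simp⟩
  smul_mem' := by
    rintro b P ⟨c, hc, hP⟩
    refine ⟨fun t => b • c t, fun t => (hc t).const_smul b, fun u x => ?_⟩
    simp only [Pi.smul_apply, smul_eq_mul, mul_assoc, ← Finset.mul_sum, ← hP]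
    rfl

lemma orderLT_mono {k l : ℕ} (h : k ≤ l) : orderLT k ≤ orderLT l := by
  rintro P ⟨c, hc, hP⟩
  refine ⟨fun t => if t < k then c t else 0, fun t => ?_, fun u x => ?_⟩
  · beta_reduce
    split_ifs
    · exact hc t
    · exact differentiable_const 0
  · rw [hP, ← Finset.sum_subset (Finset.range_mono h)]
    · exact Finset.sum_congr rfl fun t ht => by simp [Finset.mem_range.1 ht]
    · intro t _ ht
      simp [mt Finset.mem_range.2 ht]

lemma D_pow_mem_orderLT {k l : ℕ} (h : k < l) : D ^ k ∈ orderLT l := by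
  refine orderLT_mono h ⟨fun t => if t = k then 1 else 0, fun t => ?_, fun u x => ?_⟩
  · beta_reduce
    split_ifs
    · exact differentiable_const 1
    · exact differentiable_const 0
  · rw [D_pow_apply, Finset.sum_eq_single_of_mem k (by simp)]
    · simp
    · intro t _ ht
      simp [ht]

lemma X_mul_mem_orderLT {k : ℕ} {P : Module.End ℂ entire} (hP : P ∈ orderLT k) :
    X * P ∈ orderLT k := by
  obtain ⟨c, hc, hP⟩ := hP
  refine ⟨fun t x => x * c t x, fun t => differentiable_id.mul (hc t), fun u x => ?_⟩
  simp only [mul_assoc, ← Finset.mul_sum, ← hP]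
  rfl

lemma D_mul_mem_orderLT {k : ℕ} {P : Module.End ℂ entire} (hP : P ∈ orderLT k) :
    D * P ∈ orderLT (k + 1) := by
  obtain ⟨c, hc, hP⟩ := hP
  refine ⟨fun t x => (if t < k then deriv (c t) x else 0) + (if t = 0 then 0 else c (t - 1) x),
    fun t => ?_, fun u x => ?_⟩
  · refine Differentiable.add ?_ ?_
    · split_ifs
      · exact (hc t).deriv_complex
      · exact differentiable_const 0
    · split_ifs
      · exact differentiable_const 0
      · exact hc _
  · have h : HasDerivAt (P u).1 (∑ t ∈ Finset.range k,
        (deriv (c t) x * iteratedDeriv t u x + c t x * iteratedDeriv (t + 1) u x)) x := by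
      rw [funext (hP u)]
      refine HasDerivAt.fun_sum fun t _ => ?_
      rw [iteratedDeriv_succ]
      exact (hc t x).hasDerivAt.mul (Differentiable.iteratedDeriv_complex u.2 t x).hasDerivAt
    refine h.deriv.trans ?_
    rw [Finset.sum_add_distrib]
    simp only [add_mul, Finset.sum_add_distrib]
    congr 1
    · rw [Finset.sum_range_succ]
      simp only [lt_irrefl, if_false, zero_mul, add_zero]
      exact Finset.sum_congr rfl fun t ht => by rw [if_pos (Finset.mem_range.1 ht)]
    · rw [Finset.sum_range_succ']
      simp

lemma D_pow_mul_mem_orderLT {k : ℕ} {P : Module.End ℂ entire} (hP : P ∈ orderLT k) (j : ℕ) :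
    D ^ j * P ∈ orderLT (k + j) := by
  induction j with
  | zero => simpa using hP
  | succ j ih =>
    rw [pow_succ', mul_assoc]
    exact D_mul_mem_orderLT ih

lemma airy_sub_mul_mem_orderLT {r : ℕ} (hr : 1 ≤ r) (a : ℕ → ℂ) {k : ℕ} {P : Module.End ℂ entire}
    (hP : P ∈ orderLT (k + 1)) : (airy r a - D ^ r) * P ∈ orderLT (k + r) := by
  have h : (airy r a - D ^ r) * P =
      -(∑ j ∈ Finset.Ico 1 (r - 1), a j • (D ^ j * P)) - X * P := by
    rw [airy, sub_mul, sub_mul, sub_mul, Finset.sum_mul]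
    simp only [smul_mul_assoc]
    abel
  rw [h]
  refine sub_mem (neg_mem (sum_mem fun j hj => Submodule.smul_mem _ _ ?_))
    (orderLT_mono (by omega) (X_mul_mem_orderLT hP))
  have := Finset.mem_Ico.1 hj
  exact orderLT_mono (by omega) (D_pow_mul_mem_orderLT hP j)

lemma airy_pow_mul_sub_mem_orderLT {r : ℕ} (hr : 1 ≤ r) (a : ℕ → ℂ) (q p : ℕ) :
    airy r a ^ q * D ^ p - D ^ (p + r * q) ∈ orderLT (p + r * q) := by
  induction q with
  | zero => simp
  | succ q ih =>
    have h : airy r a ^ (q + 1) * D ^ p - D ^ (p + r * (q + 1)) =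
        (airy r a - D ^ r) * (D ^ (p + r * q)) +
          ((airy r a - D ^ r) * (airy r a ^ q * D ^ p - D ^ (p + r * q)) +
            D ^ r * (airy r a ^ q * D ^ p - D ^ (p + r * q))) := by
      rw [← add_mul, sub_add_cancel, mul_sub, sub_mul, ← pow_add, ← mul_assoc, ← pow_succ',
        show r + (p + r * q) = p + r * (q + 1) by ring]
      abel
    rw [h, show p + r * (q + 1) = p + r * q + r by ring]
    exact add_mem (airy_sub_mul_mem_orderLT hr a (D_pow_mem_orderLT (Nat.lt_succ_self _)))
      (add_mem (airy_sub_mul_mem_orderLT hr a (orderLT_mono (Nat.le_succ _) ih))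
        (D_pow_mul_mem_orderLT ih r))

lemma airy_pow_aeval_D_apply (r : ℕ) (a : ℕ → ℂ) (lam : ℂ) (B : Polynomial ℂ) (q : ℕ) :
    ∃ B' : Polynomial ℂ, B'.natDegree ≤ B.natDegree ∧ ∀ g : entire, airy r a g = lam • g →
      (airy r a ^ q) (Polynomial.aeval D B g) = Polynomial.aeval D B' g := by
  induction q with
  | zero => exact ⟨B, le_rfl, fun g _ => by simp⟩
  | succ q ih =>
    obtain ⟨B', hdeg, hB'⟩ := ih
    refine ⟨lam • B' + B'.derivative, ?_, fun g hg => ?_⟩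
    · refine (Polynomial.natDegree_add_le _ _).trans (max_le ?_ ?_)
      · exact (Polynomial.natDegree_smul_le _ _).trans hdeg
      · exact (B'.natDegree_derivative_le.trans (Nat.sub_le _ _)).trans hdeg
    · rw [pow_succ', Module.End.mul_apply, hB' g hg, ← Module.End.mul_apply, airy_mul_aeval_D,
        LinearMap.add_apply, Module.End.mul_apply, hg, map_smul, map_add, map_smul]
      rfl

lemma airy_pow_D_pow_apply {r : ℕ} (hr : 1 ≤ r) (a : ℕ → ℂ) (lam gam : ℂ) (q : ℕ) {p : ℕ}
    (hp : p < r) :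
    ∃ R : Fin r → Polynomial ℂ, (∀ t, (R t).natDegree ≤ if t.val = 0 then 1 else 0) ∧
      ∀ g : entire, airy r a g = lam • g → ∀ x : ℂ,
        ((airy r a ^ q * D ^ p) (gam • g + D g)).1 x = ∑ t, (R t).eval x * iteratedDeriv t g x := by
  obtain ⟨B, hdeg, hB⟩ := airy_pow_aeval_D_apply r a lam
    (Polynomial.X ^ p * (Polynomial.C gam + Polynomial.X)) q
  have hBr : B.natDegree < r + 1 := by
    refine (hdeg.trans Polynomial.natDegree_mul_le).trans_lt ?_
    have h1 := Polynomial.natDegree_X_pow_le (R := ℂ) p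
    have h2 : (Polynomial.C gam + Polynomial.X).natDegree ≤ 1 := by
      rw [add_comm, Polynomial.natDegree_X_add_C]
    omega
  refine ⟨fun t => Polynomial.C (B.coeff t + B.coeff r *
      (if t.val ∈ Finset.Ico 1 (r - 1) then a t else 0)) +
      (if t.val = 0 then Polynomial.C (B.coeff r) * (Polynomial.X + Polynomial.C lam) else 0),
    fun t => ?_, fun g hg x => ?_⟩
  · refine (Polynomial.natDegree_add_le _ _).trans ?_
    rw [Polynomial.natDegree_C, Nat.zero_max]
    split_ifs
    · refine (Polynomial.natDegree_C_mul_le _ _).trans ?_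
      rw [Polynomial.natDegree_X_add_C]
    · rw [Polynomial.natDegree_zero]
  · have hDr : iteratedDeriv r g x = lam * g.1 x + x * g.1 x +
        ∑ k ∈ Finset.Ico 1 (r - 1), a k * iteratedDeriv k g x := by
      have h := congrFun (congrArg Subtype.val hg) x
      rw [airy_apply] at h
      simp only [airyOp, Submodule.coe_smul, Pi.smul_apply, smul_eq_mul] at h
      linear_combination h
    have hop : (airy r a ^ q * D ^ p) (gam • g + D g) = Polynomial.aeval D B g := by
      rw [← hB g hg, Module.End.mul_apply]
      congr 1
      simp [Algebra.algebraMap_eq_smul_one]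
    have hIco : ∑ k ∈ Finset.Ico 1 (r - 1), a k * iteratedDeriv k g x =
        ∑ t ∈ Finset.range r,
          (if t ∈ Finset.Ico 1 (r - 1) then a t else 0) * iteratedDeriv t g x := by
      refine (Finset.sum_congr rfl fun t ht => by rw [if_pos ht]).trans (Finset.sum_subset ?_ ?_)
      · intro t ht
        have := Finset.mem_Ico.1 ht
        exact Finset.mem_range.2 (by omega)
      · intro t _ ht
        rw [if_neg ht, zero_mul]
    have h0 : (B.coeff r * (x + lam)) * g.1 x = ∑ t ∈ Finset.range r,
        (if t = 0 then B.coeff r * (x + lam) else 0) * iteratedDeriv t g x := by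
      rw [Finset.sum_eq_single_of_mem 0 (Finset.mem_range.2 hr) fun t _ ht => by simp [ht]]
      simp
    have hBg : (Polynomial.aeval D B g).1 x =
        ∑ t ∈ Finset.range (r + 1), B.coeff t * iteratedDeriv t g x := by
      rw [Polynomial.aeval_eq_sum_range' hBr]
      simp [LinearMap.sum_apply, D_pow_apply]
    rw [hop, hBg, Finset.sum_range_succ, hDr, hIco]
    rw [← Fin.sum_univ_eq_sum_range (fun t => B.coeff t * iteratedDeriv t g x)]
    rw [← Fin.sum_univ_eq_sum_range
      (fun t => (if t ∈ Finset.Ico 1 (r - 1) then a t else 0) * iteratedDeriv t g x)]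
    rw [← Fin.sum_univ_eq_sum_range
      (fun t => (if t = 0 then B.coeff r * (x + lam) else 0) * iteratedDeriv t g x)] at h0
    have hsplit : ∀ t : Fin r, (Polynomial.C (B.coeff t + B.coeff r *
        (if t.val ∈ Finset.Ico 1 (r - 1) then a t else 0)) +
        (if t.val = 0 then Polynomial.C (B.coeff r) * (Polynomial.X + Polynomial.C lam)
          else 0)).eval x * iteratedDeriv t g x =
        B.coeff t * iteratedDeriv t g x + B.coeff r *
          ((if t.val ∈ Finset.Ico 1 (r - 1) then a t else 0) * iteratedDeriv t g x) +
          (if t.val = 0 then B.coeff r * (x + lam) else 0) * iteratedDeriv t g x := by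
      intro t
      rw [Polynomial.eval_add, Polynomial.eval_C, apply_ite (Polynomial.eval x)]
      simp only [Polynomial.eval_mul, Polynomial.eval_C, Polynomial.eval_add, Polynomial.eval_X,
        Polynomial.eval_zero]
      ring
    rw [Finset.sum_congr rfl fun t _ => hsplit t, Finset.sum_add_distrib, Finset.sum_add_distrib,
      ← h0, ← Finset.mul_sum]
    ring

end entire


lemma Matrix.natDegree_det_le_sum {ι R : Type*} [Fintype ι] [DecidableEq ι] [CommRing R]
    (M : Matrix ι ι (Polynomial R)) (b : ι → ℕ) (h : ∀ p q, (M p q).natDegree ≤ b q) :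
    M.det.natDegree ≤ ∑ q, b q := by
  rw [Matrix.det_apply]
  refine Polynomial.natDegree_sum_le_of_forall_le _ _ fun σ _ => ?_
  exact (Polynomial.natDegree_smul_le _ _).trans
    ((Polynomial.natDegree_prod_le _ _).trans (Finset.sum_le_sum fun q _ => h _ q))

lemma Matrix.det_eq_of_row_eq_add_sum_lower {R : Type*} [CommRing R] {N : ℕ}
    (w : ℕ → Fin N → R) (c : Fin N → ℕ → R) (W' : Matrix (Fin N) (Fin N) R)
    (h : ∀ k s, W' k s = w k s + ∑ t ∈ Finset.range k, c k t * w t s) :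
    W'.det = (Matrix.of fun k s : Fin N => w k s).det := by
  let T : Matrix (Fin N) (Fin N) R :=
    Matrix.of fun k t => (if t = k then 1 else 0) + if t < k then c k t else 0
  have hT : T.det = 1 := by
    rw [Matrix.det_of_isLowerTriangular]
    · simp [T]
    · intro k t hkt
      have hkt : k < t := hkt
      simp [T, hkt.ne', hkt.not_gt]
  have hmul : W' = T * Matrix.of fun k s : Fin N => w k s := by
    ext k s
    have hsum : ∑ t ∈ Finset.range k, c k t * w t s =
        ∑ t : Fin N, if t < k then c k t * w t s else 0 := by
      refine (Finset.sum_congr rfl fun t ht => (if_pos (Finset.mem_range.1 ht)).symm).trans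
        ((Finset.sum_subset (Finset.range_mono k.2.le) fun t _ ht =>
          if_neg (mt Finset.mem_range.2 ht)).trans ?_)
      exact (Fin.sum_univ_eq_sum_range
        (fun t => if t < k.val then c k t * w t s else 0) N).symm
    rw [h, hsum, Matrix.mul_apply]
    simp [T, add_mul, Finset.sum_add_distrib, ite_mul]
  rw [hmul, Matrix.det_mul, hT, one_mul]

namespace entire

lemma airy_translate {r : ℕ} {a : ℕ → ℂ} {g : ℂ → ℂ} (hker : ∀ x, airyOp r a g x = 0) (s : ℂ)
    {G : entire} (hG : G.1 = fun x => g (x + s)) : airy r a G = s • G := by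
  ext x
  have h := hker (x + s)
  rw [airy_apply]
  simp only [airyOp, Submodule.coe_smul, Pi.smul_apply, smul_eq_mul, hG,
    iteratedDeriv_comp_add_const] at h ⊢
  linear_combination h

lemma linearIndependent_gam_smul_add_D {r n : ℕ} (ρ : ℕ) (a : ℕ → ℂ) {lam gam : Fin n → ℂ}
    (hlam : Function.Injective lam) {G : Fin r → Fin n → entire}
    (hG : ∀ j i, airy ρ a (G j i) = lam i • G j i)
    (hind : ∀ i, LinearIndependent ℂ fun j => G j i) :
    LinearIndependent ℂ fun p : Fin r × Fin n => gam p.2 • G p.1 p.2 + D (G p.1 p.2) := by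
  rw [Fintype.linearIndependent_iff]
  intro c hc
  let g : Fin n → entire := fun i => ∑ j, c (j, i) • G j i
  let h : Fin n → entire := fun i => gam i • g i + D (g i)
  have hg : ∀ i, airy ρ a (g i) = lam i • g i := fun i => by
    simp only [g, map_sum, map_smul, hG, Finset.smul_sum, smul_comm (lam i)]
  have hh : ∀ i, (airy ρ a - lam i • 1) (h i) = g i := fun i => by
    have hD : airy ρ a (D (g i)) = D (airy ρ a (g i)) + g i := by
      rw [← Module.End.mul_apply, airy_mul_D]
      rfl
    simp only [h, LinearMap.sub_apply, LinearMap.smul_apply, Module.End.one_apply, map_add,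
      map_smul, hD, hg, sub_self,
      smul_zero]
    abel
  have hsum : ∑ i, h i = 0 := by
    rw [← hc, Fintype.sum_prod_type_right]
    refine Finset.sum_congr rfl fun i _ => ?_
    simp only [h, g, map_sum, map_smul, Finset.smul_sum, Finset.sum_add_distrib, smul_add]
    refine congrArg₂ _ (Finset.sum_congr rfl fun j _ => smul_comm _ _ _) rfl
  have hmem : ∀ i, h i ∈ Module.End.genEigenspace (airy ρ a) (lam i) 2 := fun i => by
    refine Module.End.mem_genEigenspace_nat.2 ?_
    rw [LinearMap.mem_ker, pow_two, Module.End.mul_apply]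
    rw [hh, LinearMap.sub_apply, hg, LinearMap.smul_apply, Module.End.one_apply, sub_self]
  have h0 : ∀ i, h i = 0 := by
    have hI := (Module.End.independent_genEigenspace (airy ρ a) 2).comp hlam
    rw [iSupIndep_iff_finsetSum_eq_zero_imp_eq_zero] at hI
    exact fun i => hI Finset.univ h (fun i _ => hmem i) hsum i (Finset.mem_univ i)
  rintro ⟨j, i⟩
  have hgi : g i = 0 := by rw [← hh, h0, map_zero]
  exact Fintype.linearIndependent_iff.1 (hind i) (fun j => c (j, i)) hgi j

lemma exists_polynomial_wrDet {r n N : ℕ} (hr : 1 ≤ r) (a : ℕ → ℂ) {lam gam : Fin n → ℂ}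
    {G : Fin r → Fin n → entire} (hG : ∀ j i, airy r a (G j i) = lam i • G j i)
    (hW : ∀ i x, wrDet r (fun j => (G j i).1) x = 1) (e : Fin r × Fin n ≃ Fin N)
    {φ : Fin N → ℂ → ℂ} (hφ : ∀ p, φ (e p) = (gam p.2 • G p.1 p.2 + D (G p.1 p.2)).1) :
    ∃ P : Polynomial ℂ, P.natDegree ≤ n ∧ ∀ x, wrDet N φ x = P.eval x := by
  choose R hRdeg hR using fun (k : Fin N) (i : Fin n) =>
    airy_pow_D_pow_apply hr a (lam i) (gam i) (k.val / r) (Nat.mod_lt k.val hr)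
  let M : Matrix (Fin r × Fin n) (Fin r × Fin n) (Polynomial ℂ) :=
    Matrix.of fun p q => R (e p) q.2 q.1
  refine ⟨M.det, ?_, fun x => ?_⟩
  · refine (Matrix.natDegree_det_le_sum M (fun q => if q.1.val = 0 then 1 else 0)
      fun p q => hRdeg _ _ _).trans ?_
    rw [Fintype.sum_prod_type_right]
    obtain ⟨r, rfl⟩ := Nat.exists_eq_add_of_le' hr
    simp
  · let ψ : Fin N → entire := fun k =>
      gam (e.symm k).2 • G (e.symm k).1 (e.symm k).2 + D (G (e.symm k).1 (e.symm k).2)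
    have hψ : ∀ k, φ k = (ψ k).1 := fun k => by
      rw [← hφ, e.apply_symm_apply]
    choose c _ hc using fun k : Fin N =>
      airy_pow_mul_sub_mem_orderLT hr a (k.val / r) (k.val % r)
    let W' : Matrix (Fin N) (Fin N) ℂ :=
      Matrix.of fun k s => ((airy r a ^ (k.val / r) * D ^ (k.val % r)) (ψ s)).1 x
    have hdet : W'.det = wrDet N φ x := by
      refine Matrix.det_eq_of_row_eq_add_sum_lower (fun k s => iteratedDeriv k (φ s) x)
        (fun k t => c k t x) W' fun k s => ?_
      have h := hc k (ψ s) x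
      rw [Nat.mod_add_div, LinearMap.sub_apply, Submodule.coe_sub, Pi.sub_apply, D_pow_apply] at h
      simp only [hψ]
      exact (sub_eq_iff_eq_add'.1 h)
    have hfac : W'.submatrix e e = (M.map (Polynomial.eval x)) * Matrix.blockDiagonal fun i =>
        Matrix.of fun t j : Fin r => iteratedDeriv t.val (G j i).1 x := by
      ext p ⟨j, i⟩
      have h := hR (e p) i (G j i) (hG j i) x
      rw [Matrix.mul_apply, Fintype.sum_prod_type_right]
      simp only [Matrix.blockDiagonal_apply, Matrix.map_apply, mul_ite, mul_zero]
      rw [Finset.sum_eq_single i (fun i' _ hi' => by simp [hi']) (by simp)]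
      simpa [M, W', ψ] using h
    have hM : (M.map (Polynomial.eval x)).det = M.det.eval x :=
      ((Polynomial.evalRingHom x).map_det M).symm
    rw [← hdet, ← Matrix.det_submatrix_equiv_self e, hfac, Matrix.det_mul, hM,
      Matrix.det_blockDiagonal]
    exact (congrArg _ (Finset.prod_eq_one fun i _ => hW i x)).trans (mul_one _)

end entire

lemma linearIndependent_of_wrDet_ne_zero {m : ℕ} {G : Fin m → entire} {x : ℂ}
    (h : wrDet m (fun j => (G j).1) x ≠ 0) : LinearIndependent ℂ G := by
  rw [Fintype.linearIndependent_iff]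
  intro c hc
  refine fun i => congrFun (Matrix.eq_zero_of_mulVec_eq_zero h (v := c) ?_) i
  ext k
  have hk := congrArg (fun u : entire => ((entire.D ^ k.val) u).1 x) hc
  simp only [map_sum, map_smul, map_zero] at hk
  simpa [Matrix.mulVec, dotProduct, entire.D_pow_apply, mul_comm] using hk

theorem statement14 (r n : ℕ) (a : ℕ → ℂ) (f : ℕ → ℂ → ℂ) (lam gam : ℕ → ℂ)
    (hr : 2 ≤ r) (hn : 1 ≤ n)
    (hf : ∀ j < r, Differentiable ℂ (f j))
    (hker : ∀ j < r, ∀ x : ℂ, airyOp r a (f j) x = 0)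
    (hwrf : ∀ x : ℂ, wrDet r (fun j => f j.val) x = 1)
    (hlam : ∀ i < n, ∀ j < n, i ≠ j → lam i ≠ lam j)
    (m d : ℕ → ℕ) (nu : ℕ → ℕ → ℂ) (A : ℕ → ℕ → ℕ → ℂ)
    (hann : ∀ s < n + 1, ∀ u : ℂ → ℂ, Differentiable ℂ u →
      ∑ l ∈ Finset.range (m s), ∑ j ∈ Finset.range (d s + 1),
        A s l j * iteratedDeriv j (wrDetB (r * n) (phiFam r n f lam gam) u) (nu s l) = 0) :
    ∃ β : ℕ → ℂ, (∃ s < n + 1, β s ≠ 0) ∧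
      ∀ v : ℂ → ℂ, Differentiable ℂ v →
        ∑ s ∈ Finset.range (n + 1), β s *
            (∑ l ∈ Finset.range (m s), ∑ j ∈ Finset.range (d s + 1),
              A s l j * iteratedDeriv j v (nu s l)) = 0 := by
  have hG : ∀ (j : Fin r) (i : Fin n), Differentiable ℂ fun x => f j.val (x + lam i.val) :=
    fun j i => (hf j j.2).comp (differentiable_id.add_const _)
  let G : Fin r → Fin n → entire := fun j i => ⟨_, hG j i⟩
  let e : Fin r × Fin n ≃ Fin (r * n) :=
    (Equiv.prodComm _ _).trans (finProdFinEquiv.trans (finCongr (mul_comm n r)))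
  have hr0 : 0 < r := by omega
  have hφ : ∀ p, phiFam r n f lam gam (e p) =
      (gam p.2.val • G p.1 p.2 + entire.D (G p.1 p.2)).1 := by
    rintro ⟨j, i⟩
    have he : (e (j, i)).val = j.val + r * i.val := rfl
    have hdiv : (e (j, i)).val / r = i.val := by
      rw [he, Nat.add_mul_div_left _ _ hr0, Nat.div_eq_of_lt j.2, zero_add]
    have hmod : (e (j, i)).val % r = j.val := by
      rw [he, Nat.add_mul_mod_self_left, Nat.mod_eq_of_lt j.2]
    funext x
    rw [phiFam, hdiv, hmod, ← deriv_comp_add_const]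
    rfl
  have hairy : ∀ j i, entire.airy r a (G j i) = lam i.val • G j i := fun j i =>
    entire.airy_translate (hker j j.2) _ rfl
  have hW : ∀ i x, wrDet r (fun j => (G j i).1) x = 1 := fun i x => by
    refine Eq.trans ?_ (hwrf (x + lam i.val))
    simp only [wrDet, G, iteratedDeriv_comp_add_const]
  have hGind : ∀ i, LinearIndependent ℂ fun j => G j i := fun i =>
    linearIndependent_of_wrDet_ne_zero (G := fun j => G j i) (x := 0) (by
      rw [hW]
      exact one_ne_zero)
  have hinj : Function.Injective fun i : Fin n => lam i.val := fun i i' h =>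
    Fin.ext (not_imp_not.1 (hlam i i.2 i' i'.2) h)
  have hind : LinearIndependent ℂ (phiFam r n f lam gam) := by
    rw [← linearIndependent_equiv e, show phiFam r n f lam gam ∘ e = _ from funext hφ]
    exact (entire.linearIndependent_gam_smul_add_D (gam := fun i => gam i.val) r a hinj hairy
      hGind).map' entire.subtype entire.ker_subtype
  have hdiff : ∀ k, Differentiable ℂ (phiFam r n f lam gam k) := fun k => by
    rw [← e.apply_symm_apply k, hφ]
    exact Subtype.prop _
  obtain ⟨P, hdeg, hP⟩ := entire.exists_polynomial_wrDet hr0 a hairy hW e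
    (gam := fun i => gam i.val) hφ
  obtain ⟨β, hβ, h⟩ := exists_relation_of_annihilates hdiff hind hP hdeg m d nu A hann
  exact ⟨β, hβ, fun v _ => h v⟩
end

section
/- Let c be a finitely supported distribution, c(v) = Σ_{l=1}^m Σ_{j=0}^d a_{l,j}·v^{(j)}(ν_l) (a finite sum with ν_l ∈ ℂ, a_{l,j} ∈ ℂ), and for f in the ℂ-span of f_1, …, f_r let c(f̂) denote the entire function x ↦ Σ_{l,j} a_{l,j}·f^{(j)}(x+ν_l). Then the following are equivalent: (i) F(c(f̂)) = 0 for every f in the span of f_1, …, f_r; (ii) c(det Wr(φ_1, …, φ_N, u)) = 0 for every entire function u, where det Wr(φ_1, …, φ_N, u) is regarded as an entire function of its variable. (That is, C^β = {c : c(f̂) ∈ ker ♭K̄ for all f ∈ ker L₀} = {c : c∘K̄(z,∂_z) = 0}.) -/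
open scoped BigOperators

/-- The polynomial `p` evaluated at the operator `L₀`. -/
noncomputable def polyOpAiry (r : ℕ) (a : ℕ → ℂ) (p : Polynomial ℂ) (u : ℂ → ℂ) : ℂ → ℂ :=
  fun x => ∑ k ∈ Finset.range (p.natDegree + 1), p.coeff k * (airyOp r a)^[k] u x

/-- The index set of pairs `(i,j)` with `i ≤ n`, `j ≤ r-1` and `i·r + j ≤ N = r·n`. -/
def idxSet (r n : ℕ) : Finset (ℕ × ℕ) :=
  (Finset.range (n + 1) ×ˢ Finset.range r).filter fun q => q.1 * r + q.2 ≤ r * n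

/-- `K` is the (unique) family of polynomial coefficients expressing the Wronskian
operator `u ↦ det Wr(φ₁, …, φ_N, u)` as `∑ K_{i,j}(x)·(d/dx)^j (L₀^i u)(x)`. -/
def ExpProp (r n : ℕ) (a : ℕ → ℂ) (φ : Fin (r * n) → ℂ → ℂ)
    (K : ℕ → ℕ → Polynomial ℂ) : Prop :=
  (∀ i j : ℕ, (i, j) ∉ idxSet r n → K i j = 0) ∧
  ∀ u : ℂ → ℂ, Differentiable ℂ u → ∀ x : ℂ,
    wrDetB (r * n) φ u x =
      ∑ q ∈ idxSet r n, (K q.1 q.2).eval x * iteratedDeriv q.2 ((airyOp r a)^[q.1] u) x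

/-- The ♭-transformed operator `F u = ∑_{i,j} x^i·(d/dx)^j (K_{i,j}(L₀) u)`. -/
noncomputable def Fop (r n : ℕ) (a : ℕ → ℂ) (K : ℕ → ℕ → Polynomial ℂ)
    (u : ℂ → ℂ) : ℂ → ℂ :=
  fun x => ∑ q ∈ idxSet r n, x ^ q.1 * iteratedDeriv q.2 (polyOpAiry r a (K q.1 q.2) u) x

open Polynomial hiding X

/-- The algebra of entire functions. -/
def entireSubalgebra : Subalgebra ℂ (ℂ → ℂ) where
  carrier := {u | Differentiable ℂ u}
  mul_mem' hu hv := Differentiable.mul hu hv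
  add_mem' hu hv := Differentiable.add hu hv
  algebraMap_mem' c := differentiable_const c

/-- The type of entire functions. -/
def Entire : Type := entireSubalgebra

namespace Entire

instance : CommRing Entire := inferInstanceAs (CommRing entireSubalgebra)

instance : Algebra ℂ Entire := inferInstanceAs (Algebra ℂ entireSubalgebra)

instance : FunLike Entire ℂ ℂ := ⟨fun u => u.1, Subtype.val_injective⟩

@[ext]
theorem ext {u v : Entire} (h : ∀ x, u x = v x) : u = v := DFunLike.ext u v h

theorem differentiable (u : Entire) : Differentiable ℂ u := u.2

/-- An entire function as an element of `Entire`. -/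
def mk (u : ℂ → ℂ) (hu : Differentiable ℂ u) : Entire := ⟨u, hu⟩

@[simp]
theorem coe_mk (u : ℂ → ℂ) (hu : Differentiable ℂ u) : ⇑(mk u hu) = u := rfl

@[simp]
theorem add_apply (u v : Entire) (x : ℂ) : (u + v) x = u x + v x := rfl

@[simp]
theorem sub_apply (u v : Entire) (x : ℂ) : (u - v) x = u x - v x := rfl

@[simp]
theorem mul_apply (u v : Entire) (x : ℂ) : (u * v) x = u x * v x := rfl

@[simp]
theorem smul_apply (s : ℂ) (u : Entire) (x : ℂ) : (s • u) x = s * u x := rfl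

@[simp]
theorem zero_apply (x : ℂ) : (0 : Entire) x = 0 := rfl

/-- Differentiation of entire functions. -/
noncomputable def D : Module.End ℂ Entire where
  toFun u := mk (deriv u) (differentiable u).deriv
  map_add' u v := by
    ext x
    exact deriv_add (differentiable u x) (differentiable v x)
  map_smul' c u := by
    ext x
    exact deriv_const_smul c (differentiable u x)

/-- The coordinate function. -/
def z : Entire := mk (fun x => x) differentiable_id

/-- Multiplication by the coordinate. -/
noncomputable def X : Module.End ℂ Entire := Algebra.lmul ℂ Entire z

/-- Translation `u ↦ u (x + ·)`. -/
def trans (x : ℂ) : Module.End ℂ Entire where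
  toFun u := ⟨fun y => u (x + y),
    (differentiable u).comp ((differentiable_const x).add differentiable_id)⟩
  map_add' _ _ := rfl
  map_smul' _ _ := rfl

/-- Evaluation at a point. -/
def ev (x : ℂ) : Module.Dual ℂ Entire where
  toFun u := u x
  map_add' _ _ := rfl
  map_smul' _ _ := rfl

/-- The generalized Airy operator on entire functions. -/
noncomputable def L (r : ℕ) (a : ℕ → ℂ) : Module.End ℂ Entire :=
  D ^ r - (∑ k ∈ Finset.Ico 1 (r - 1), a k • D ^ k) - X

theorem coe_D (u : Entire) : ⇑(D u) = deriv u := rfl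

theorem X_apply (u : Entire) : X u = z * u := rfl

theorem coe_X (u : Entire) (x : ℂ) : X u x = x * u x := rfl

theorem trans_apply (x y : ℂ) (u : Entire) :
    trans x u y = u (x + y) := rfl

theorem ev_apply (x : ℂ) (u : Entire) : ev x u = u x := rfl

theorem coe_sum_apply {ι : Type*} (s : Finset ι) (g : ι → Entire) (x : ℂ) :
    (∑ i ∈ s, g i) x = ∑ i ∈ s, (g i) x :=
  map_sum (ev x) g s

theorem coe_D_pow (k : ℕ) (u : Entire) :
    ((D ^ k) u : ℂ → ℂ) = iteratedDeriv k u := by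
  induction k with
  | zero => simp
  | succ k ih => rw [pow_succ', Module.End.mul_apply, coe_D, ih, iteratedDeriv_succ]

theorem coe_L (r : ℕ) (a : ℕ → ℂ) (u : Entire) :
    (L r a u) = airyOp r a u := by
  funext x
  have : (L r a u) x = ((D ^ r) u : ℂ → ℂ) x
      - ((∑ k ∈ Finset.Ico 1 (r - 1), a k • (D ^ k) u : Entire) : ℂ → ℂ) x
      - X u x := by
    simp [L, LinearMap.sub_apply, LinearMap.sum_apply]
  rw [this, coe_sum_apply, coe_D_pow, coe_X, airyOp]
  simp [coe_D_pow]

theorem coe_L_pow (r : ℕ) (a : ℕ → ℂ) (k : ℕ) (u : Entire) :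
    ((L r a ^ k) u : ℂ → ℂ) = (airyOp r a)^[k] u := by
  induction k with
  | zero => simp
  | succ k ih =>
    rw [pow_succ', Module.End.mul_apply, coe_L, ih, Function.iterate_succ_apply']

theorem coe_aeval_L (r : ℕ) (a : ℕ → ℂ) (p : ℂ[X]) (u : Entire) :
    (aeval (L r a) p u : ℂ → ℂ) = polyOpAiry r a p u := by
  funext x
  rw [aeval_eq_sum_range, LinearMap.sum_apply, coe_sum_apply, polyOpAiry]
  simp [coe_L_pow]

theorem aeval_X_apply (p : ℂ[X]) (u : Entire) : aeval X p u = aeval z p * u := by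
  rw [X, aeval_algHom_apply]
  rfl

theorem coe_aeval_z (p : ℂ[X]) (x : ℂ) : (aeval z p) x = p.eval x := by
  have h : aeval x p = (aeval z p) x :=
    aeval_algHom_apply ((Pi.evalAlgHom ℂ (fun _ : ℂ => ℂ) x).comp entireSubalgebra.val) z p
  rw [← h, coe_aeval_eq_eval]

theorem coe_X_pow (k : ℕ) (u : Entire) (x : ℂ) : ((X ^ k) u) x = x ^ k * u x := by
  induction k with
  | zero => simp
  | succ k ih => rw [pow_succ', Module.End.mul_apply, coe_X, ih, pow_succ', mul_assoc]

theorem D_mul (u v : Entire) : D (u * v) = D u * v + u * D v := by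
  ext x
  exact deriv_mul (differentiable u x) (differentiable v x)

theorem D_z : D z = 1 := by
  ext x
  exact deriv_id x

theorem D_mul_X : D * X = X * D + 1 := by
  ext1 u
  simp [X_apply, D_mul, D_z, add_comm]

theorem D_mul_trans (x : ℂ) : D * trans x = trans x * D := by
  ext u y
  exact deriv_comp_const_add (f := u) x y

theorem X_mul_trans (x : ℂ) : X * trans x = trans x * X - x • trans x := by
  ext u y
  change y * u (x + y) = (x + y) * u (x + y) - x * u (x + y)
  ring

theorem sub_sum_sub_mul_of_commute {R : Type*} [Ring R] [Algebra ℂ R] (r : ℕ) (a : ℕ → ℂ)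
    {D X Φ Y : R} (hD : Commute D Φ) (hX : X * Φ = Φ * X - Y) :
    (D ^ r - (∑ k ∈ Finset.Ico 1 (r - 1), a k • D ^ k) - X) * Φ
      = Φ * (D ^ r - (∑ k ∈ Finset.Ico 1 (r - 1), a k • D ^ k) - X) + Y := by
  simp only [sub_mul, mul_sub, Finset.sum_mul, Finset.mul_sum, smul_mul_assoc,
    mul_smul_comm, fun k => (hD.pow_left k).eq, hX]
  abel

theorem L_trans (r : ℕ) (a : ℕ → ℂ) (x : ℂ) {f : Entire} (hf : L r a f = 0) :
    L r a (trans x f) = x • trans x f := by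
  have h : L r a * trans x = trans x * L r a + x • trans x :=
    sub_sum_sub_mul_of_commute r a (D_mul_trans x) (X_mul_trans x)
  have := LinearMap.congr_fun h f
  simpa [hf] using this

theorem L_apply_of_commute (r : ℕ) (a : ℕ → ℂ) {Φ : Module.End ℂ Entire}
    (hΦ : Commute D Φ) {f : Entire} (hf : L r a f = 0) :
    L r a (Φ f) = Φ (X f) - X (Φ f) := by
  have h : L r a * Φ = Φ * L r a + (Φ * X - X * Φ) :=
    sub_sum_sub_mul_of_commute r a hΦ (sub_sub_cancel _ _).symm
  have := LinearMap.congr_fun h f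
  simpa [hf] using this

/-- Functionals which are represented by an operator commuting with differentiation and which
vanish on the multiples of some nonzero polynomial. -/
def T : Submodule ℂ (Module.Dual ℂ Entire) where
  carrier := {c | (∃ Φ : Module.End ℂ Entire, Commute D Φ ∧
      ∀ u x, (Φ u) x = c (trans x u)) ∧
    ∃ P : ℂ[X], P ≠ 0 ∧ ∀ h : Entire, c (aeval z P * h) = 0}
  add_mem' := by
    rintro c c' ⟨⟨Φ, h1, h2⟩, P, hP, h3⟩ ⟨⟨Φ', h1', h2'⟩, P', hP', h3'⟩
    refine ⟨⟨Φ + Φ', h1.add_right h1', fun u x => ?_⟩, P * P', mul_ne_zero hP hP', fun h => ?_⟩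
    · simp [h2, h2']
    · rw [LinearMap.add_apply, map_mul (aeval z), mul_assoc, h3, mul_left_comm, h3', add_zero]
  zero_mem' := ⟨⟨0, Commute.zero_right _, fun _ _ => rfl⟩, 1, one_ne_zero, fun _ => rfl⟩
  smul_mem' := by
    rintro s c ⟨⟨Φ, h1, h2⟩, P, hP, h3⟩
    refine ⟨⟨s • Φ, h1.smul_right s, fun u x => ?_⟩, P, hP, fun h => ?_⟩
    · simp [h2]
    · simp [h3]

theorem ev_mem_T (x : ℂ) : ev x ∈ T := by
  refine ⟨⟨trans x, D_mul_trans x, fun u y => ?_⟩, Polynomial.X - C x, X_sub_C_ne_zero x,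
    fun h => ?_⟩
  · rw [ev_apply, trans_apply, trans_apply, add_comm]
  · change (aeval z (Polynomial.X - C x) : ℂ → ℂ) x * h x = 0
    rw [coe_aeval_z]
    simp

theorem comp_D_mem_T {c : Module.Dual ℂ Entire} (hc : c ∈ T) : c ∘ₗ D ∈ T := by
  obtain ⟨⟨Φ, h1, h2⟩, P, hP, h3⟩ := hc
  refine ⟨⟨Φ * D, h1.mul_right (Commute.refl D), fun u x => ?_⟩, P * P, mul_ne_zero hP hP,
    fun h => ?_⟩
  · have := LinearMap.congr_fun (D_mul_trans x) u
    simp only [Module.End.mul_apply] at this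
    rw [Module.End.mul_apply, h2, LinearMap.comp_apply, this]
  · rw [LinearMap.comp_apply, map_mul (aeval z), mul_assoc, D_mul, D_mul, map_add, h3]
    rw [show ∀ v w : Entire, v * (aeval z P * w) = aeval z P * (v * w) from
      fun v w => mul_left_comm _ _ _, h3, add_zero]

theorem comp_X_mem_T {c : Module.Dual ℂ Entire} (hc : c ∈ T) : c ∘ₗ X ∈ T := by
  obtain ⟨⟨Φ, h1, h2⟩, P, hP, h3⟩ := hc
  refine ⟨⟨Φ * X - X * Φ, ?_, fun u x => ?_⟩, P, hP, fun h => ?_⟩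
  · have e1 : D * Φ = Φ * D := h1
    change D * (Φ * X - X * Φ) = (Φ * X - X * Φ) * D
    calc D * (Φ * X - X * Φ) = D * Φ * X - D * X * Φ := by rw [mul_sub, mul_assoc, mul_assoc]
      _ = Φ * (D * X) - D * X * Φ := by rw [e1, mul_assoc]
      _ = Φ * X * D - X * (D * Φ) := by
        simp only [D_mul_X, mul_add, add_mul, mul_one, one_mul, mul_assoc]
        abel
      _ = (Φ * X - X * Φ) * D := by rw [e1, sub_mul, mul_assoc X]
  · have := LinearMap.congr_fun (X_mul_trans x) u
    simp only [Module.End.mul_apply, LinearMap.sub_apply, LinearMap.smul_apply] at this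
    rw [LinearMap.comp_apply, this, map_sub, map_smul, ← h2, ← h2]
    rfl
  · rw [LinearMap.comp_apply, X_apply, mul_left_comm, h3]

/-- `A` acting on functionals from the right corresponds to `A'` acting on the functions
`x ↦ c (trans x f)`. -/
def Bispectral (f : Entire) (A A' : Module.End ℂ Entire) : Prop :=
  ∀ c ∈ T, c ∘ₗ A ∈ T ∧ ∀ g : Entire, (∀ x, g x = c (trans x f)) →
    ∀ x, (A' g) x = c (A (trans x f))

namespace Bispectral

variable {f : Entire} {A A' B B' : Module.End ℂ Entire}

theorem add (h : Bispectral f A A') (h' : Bispectral f B B') : Bispectral f (A + B) (A' + B') := by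
  intro c hc
  refine ⟨?_, fun g hg x => ?_⟩
  · rw [LinearMap.comp_add]
    exact T.add_mem (h c hc).1 (h' c hc).1
  · have e1 := (h c hc).2 g hg x
    have e2 := (h' c hc).2 g hg x
    simp [e1, e2]

theorem sub (h : Bispectral f A A') (h' : Bispectral f B B') :
    Bispectral f (A - B) (A' - B') := by
  intro c hc
  refine ⟨?_, fun g hg x => ?_⟩
  · rw [LinearMap.comp_sub]
    exact T.sub_mem (h c hc).1 (h' c hc).1
  · have e1 := (h c hc).2 g hg x
    have e2 := (h' c hc).2 g hg x
    simp [e1, e2]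

theorem smul (s : ℂ) (h : Bispectral f A A') : Bispectral f (s • A) (s • A') := by
  intro c hc
  refine ⟨?_, fun g hg x => ?_⟩
  · rw [LinearMap.comp_smul]
    exact T.smul_mem s (h c hc).1
  · have e1 := (h c hc).2 g hg x
    simp [e1]

theorem mul (h : Bispectral f A A') (h' : Bispectral f B B') : Bispectral f (A * B) (B' * A') := by
  intro c hc
  obtain ⟨h1, h2⟩ := h c hc
  obtain ⟨h3, h4⟩ := h' _ h1
  exact ⟨h3, fun g hg x => h4 (A' g) (h2 g hg) x⟩

theorem one : Bispectral f 1 1 := fun _ hc => ⟨hc, fun _ hg => hg⟩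

theorem zero : Bispectral f 0 0 := fun c _ =>
  ⟨by rw [LinearMap.comp_zero]; exact T.zero_mem, fun g _ x => by simp⟩

theorem sum {ι : Type*} (s : Finset ι) {A A' : ι → Module.End ℂ Entire}
    (h : ∀ i ∈ s, Bispectral f (A i) (A' i)) : Bispectral f (∑ i ∈ s, A i) (∑ i ∈ s, A' i) := by
  classical
  induction s using Finset.induction_on with
  | empty => simpa using zero
  | insert i s hi ih =>
    rw [Finset.sum_insert hi, Finset.sum_insert hi]
    exact (h i (Finset.mem_insert_self i s)).add
      (ih fun j hj => h j (Finset.mem_insert_of_mem hj))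

theorem pow (h : Bispectral f A A') (k : ℕ) : Bispectral f (A ^ k) (A' ^ k) := by
  induction k with
  | zero => simpa using one
  | succ k ih =>
    rw [pow_succ, pow_succ']
    exact ih.mul h

theorem aeval (h : Bispectral f A A') (p : ℂ[X]) :
    Bispectral f (Polynomial.aeval A p) (Polynomial.aeval A' p) := by
  rw [aeval_eq_sum_range, aeval_eq_sum_range]
  exact sum _ fun k _ => (h.pow k).smul _

end Bispectral

theorem bispectral_D (f : Entire) : Bispectral f D D := by
  intro c hc
  refine ⟨comp_D_mem_T hc, fun g hg x => ?_⟩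
  obtain ⟨⟨Φ, h1, h2⟩, -⟩ := hc
  obtain rfl : g = Φ f := ext fun x => by rw [hg, h2]
  have e1 := LinearMap.congr_fun h1 f
  have e2 := LinearMap.congr_fun (D_mul_trans x) f
  simp only [Module.End.mul_apply] at e1 e2
  rw [e1, e2, h2]

theorem bispectral_X (r : ℕ) (a : ℕ → ℂ) {f : Entire} (hf : L r a f = 0) :
    Bispectral f X (L r a) := by
  intro c hc
  refine ⟨comp_X_mem_T hc, fun g hg x => ?_⟩
  obtain ⟨⟨Φ, h1, h2⟩, -⟩ := hc
  obtain rfl : g = Φ f := ext fun x => by rw [hg, h2]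
  have e2 := LinearMap.congr_fun (X_mul_trans x) f
  simp only [Module.End.mul_apply, LinearMap.sub_apply, LinearMap.smul_apply] at e2
  rw [L_apply_of_commute r a h1 hf, e2, map_sub, map_smul, ← h2, ← h2]
  rfl

theorem bispectral_L (r : ℕ) (a : ℕ → ℂ) {f : Entire} (hf : L r a f = 0) :
    Bispectral f (L r a) X := by
  intro c hc
  refine ⟨?_, fun g hg x => ?_⟩
  · have hD := bispectral_D f
    exact ((((hD.pow r).sub (Bispectral.sum (Finset.Ico 1 (r - 1))
      fun k _ => (hD.pow k).smul (a k))).sub (bispectral_X r a hf)) c hc).1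
  · rw [L_trans r a x hf, map_smul, ← hg, coe_X, smul_eq_mul]

/-- Division with polynomial remainder of an entire function by a product of linear factors. -/
theorem exists_eq_aeval_add (s : Multiset ℂ) (u : Entire) :
    ∃ (q : ℂ[X]) (h : Entire),
      u = aeval z q + aeval z (s.map fun w => Polynomial.X - C w).prod * h := by
  induction s using Multiset.induction_on generalizing u with
  | empty => exact ⟨0, u, by simp⟩
  | cons w s ih =>
    have hd : Differentiable ℂ (dslope u w) := by
      rw [← differentiableOn_univ, Complex.differentiableOn_dslope Filter.univ_mem]
      exact (differentiable u).differentiableOn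
    obtain ⟨q, h, hq⟩ := ih (mk _ hd)
    refine ⟨C (u w) + (Polynomial.X - C w) * q, h, ?_⟩
    have e : u - aeval z (C (u w)) =
         aeval z (Polynomial.X - C w) * ((mk _ hd) : Entire) := by
      ext x
      change u x - aeval z (C (u w)) x
        = (aeval z (Polynomial.X - C w)) x * dslope u w x
      rw [coe_aeval_z, coe_aeval_z]
      simpa using (sub_smul_dslope u w x).symm
    rw [hq] at e
    rw [Multiset.map_cons, Multiset.prod_cons, map_add, map_mul, map_mul]
    linear_combination e

theorem exists_eq_aeval_add_mul {P : ℂ[X]} (hP : P ≠ 0) (u : Entire) :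
    ∃ (q : ℂ[X]) (h : Entire), u = aeval z q + aeval z P * h := by
  obtain ⟨q, h, e⟩ := exists_eq_aeval_add P.roots u
  have hl : P.leadingCoeff ≠ 0 := leadingCoeff_ne_zero.mpr hP
  refine ⟨q, P.leadingCoeff⁻¹ • h, ?_⟩
  nth_rewrite 1 [(IsAlgClosed.splits P).eq_prod_roots]
  rw [e, map_mul, aeval_C, Algebra.algebraMap_eq_smul_one, smul_mul_assoc, one_mul,
    smul_mul_smul_comm, mul_inv_cancel₀ hl, one_smul]

/-- A functional vanishing on the multiples of `P` and on all polynomial multiples of a function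
without zeros at the roots of `P` is zero. -/
theorem eq_zero_of_aeval_mul {c : Module.Dual ℂ Entire} {P : ℂ[X]} (hP : P ≠ 0)
    (hc : ∀ h : Entire, c (aeval z P * h) = 0) {g : Entire}
    (hg : ∀ w ∈ P.roots, g w ≠ 0) (hcg : ∀ p : ℂ[X], c (aeval z p * g) = 0) :
    c = 0 := by
  obtain ⟨q, h, e⟩ := exists_eq_aeval_add_mul hP g
  have hcop : IsCoprime q P := by
    refine isCoprime_of_irreducible_dvd (fun h => hP h.2) fun π hπ h1 h2 => ?_
    obtain ⟨w, hw⟩ := IsAlgClosed.exists_root π (degree_pos_of_irreducible hπ).ne'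
    have hwP : P.eval w = 0 := (IsRoot.dvd hw h2)
    refine hg w ((mem_roots hP).2 hwP) ?_
    rw [e]
    change (aeval z q) w + (aeval z P) w * h w = 0
    rw [coe_aeval_z, coe_aeval_z, hwP, IsRoot.dvd hw h1]
    simp
  obtain ⟨s, t, hst⟩ := hcop
  ext1 u
  obtain ⟨q', h', e'⟩ := exists_eq_aeval_add_mul hP u
  have hst' := congrArg (aeval z) hst
  simp only [map_add, map_mul, map_one] at hst'
  have : u = aeval z (q' * s) * g
      + aeval z P * (h' + aeval z q' * aeval z t - aeval z q' * aeval z s * h) := by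
    rw [map_mul, e, e']
    linear_combination (-aeval z q') * hst'
  rw [this, map_add, hcg, hc, add_zero, LinearMap.zero_apply]

/-- Some translate of a nonzero entire function has no zero in a given finite set. -/
theorem exists_shift_ne_zero {f : Entire} (hf : f ≠ 0) (s : Finset ℂ) :
    ∃ x, ∀ w ∈ s, f (x + w) ≠ 0 := by
  have h : ∀ᶠ x in nhdsWithin (0 : ℂ) {0}ᶜ, ∀ w ∈ s, f (x + w) ≠ 0 := by
    rw [Filter.eventually_all_finset]
    intro w _
    have hd : Differentiable ℂ fun x => f (x + w) :=
      (differentiable f).comp (differentiable_id.add (differentiable_const w))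
    refine (hd.analyticAt 0).eventually_eq_zero_or_eventually_ne_zero.resolve_left fun h0 => hf ?_
    have h1 := AnalyticOnNhd.eq_of_eventuallyEq (g := fun _ => (0 : ℂ))
      (fun x _ => hd.analyticAt x) (fun x _ => analyticAt_const) h0
    ext x
    simpa using congrFun h1 (x - w)
  exact h.exists

/-- A functional in `T` which annihilates all translates of a nonzero `f ∈ ker L` is zero. -/
theorem eq_zero_of_trans {r : ℕ} {a : ℕ → ℂ} {f : Entire} (hf : L r a f = 0)
    (hf0 : f ≠ 0) {c : Module.Dual ℂ Entire} (hc : c ∈ T) (h0 : ∀ x, c (trans x f) = 0) :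
    c = 0 := by
  obtain ⟨-, P, hP, hcP⟩ := id hc
  obtain ⟨x, hx⟩ := exists_shift_ne_zero hf0 P.roots.toFinset
  refine eq_zero_of_aeval_mul hP hcP (g := trans x f)
    (fun w hw => hx w (Multiset.mem_toFinset.2 hw)) fun p => ?_
  have h := (((bispectral_X r a hf).aeval p) c hc).2 0 (fun x => (h0 x).symm) x
  rw [aeval_X_apply] at h
  rw [← h, map_zero, zero_apply]

end Entire

open Entire in
theorem statement15 (r n : ℕ) (a : ℕ → ℂ) (f : ℕ → ℂ → ℂ) (lam gam : ℕ → ℂ)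
    (hr : 2 ≤ r) (hn : 1 ≤ n)
    (hf : ∀ j < r, Differentiable ℂ (f j))
    (hker : ∀ j < r, ∀ x : ℂ, airyOp r a (f j) x = 0)
    (hwrf : ∀ x : ℂ, wrDet r (fun j => f j.val) x = 1)
    (hlam : ∀ i < n, ∀ j < n, i ≠ j → lam i ≠ lam j)
    (K : ℕ → ℕ → Polynomial ℂ)
    (hK : ExpProp r n a (phiFam r n f lam gam) K)
    (m d : ℕ) (nu : ℕ → ℂ) (A : ℕ → ℕ → ℂ) :
    (∀ b : ℕ → ℂ, ∀ x : ℂ,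
        Fop r n a K
          (fun t => ∑ l ∈ Finset.range m, ∑ j ∈ Finset.range (d + 1),
            A l j * iteratedDeriv j (fun s => ∑ j' ∈ Finset.range r, b j' * f j' s) (t + nu l)) x
          = 0)
      ↔ (∀ u : ℂ → ℂ, Differentiable ℂ u →
          ∑ l ∈ Finset.range m, ∑ j ∈ Finset.range (d + 1),
            A l j * iteratedDeriv j (wrDetB (r * n) (phiFam r n f lam gam) u) (nu l) = 0) := by
  
  set c : Module.Dual ℂ Entire := ∑ l ∈ Finset.range m, ∑ j ∈ Finset.range (d + 1),
    A l j • (ev (nu l) ∘ₗ D ^ j) with hc_def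
  have hD_mem {c : Module.Dual ℂ Entire} (hc : c ∈ T) (k : ℕ) : c ∘ₗ D ^ k ∈ T :=
    (((bispectral_D 0).pow k) c hc).1
  have hc : c ∈ T := T.sum_mem fun l _ => T.sum_mem fun j _ =>
    T.smul_mem _ (hD_mem (ev_mem_T _) j)
  have hc_apply (u : Entire) : c u = ∑ l ∈ Finset.range m, ∑ j ∈ Finset.range (d + 1),
      A l j * iteratedDeriv j u (nu l) := by
    simp [hc_def, LinearMap.sum_apply, ev_apply, coe_D_pow]
  set Kbar : Module.End ℂ Entire := ∑ q ∈ idxSet r n,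
    aeval X (K q.1 q.2) * (D ^ q.2 * L r a ^ q.1) with hKbar
  set Fo : Module.End ℂ Entire := ∑ q ∈ idxSet r n,
    X ^ q.1 * D ^ q.2 * aeval (L r a) (K q.1 q.2) with hFo
  have hwr (u : Entire) : wrDetB (r * n) (phiFam r n f lam gam) u = Kbar u := by
    funext x
    rw [hK.2 u (differentiable u) x, hKbar, LinearMap.sum_apply, coe_sum_apply]
    refine Finset.sum_congr rfl fun q _ => ?_
    rw [Module.End.mul_apply, Module.End.mul_apply, aeval_X_apply, mul_apply, coe_aeval_z,
      coe_D_pow, coe_L_pow]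
  have hFop (u : Entire) : Fop r n a K u = Fo u := by
    funext x
    rw [hFo, LinearMap.sum_apply, coe_sum_apply, Fop]
    refine Finset.sum_congr rfl fun q _ => ?_
    rw [Module.End.mul_apply, Module.End.mul_apply, coe_X_pow, coe_D_pow, coe_aeval_L]
  let g : ℕ → Entire := fun j => if h : j < r then mk (f j) (hf j h) else 0
  have hg {j : ℕ} (hj : j < r) : ⇑(g j) = f j := by simp [g, hj]
  have hLg {j : ℕ} (hj : j < r) : L r a (g j) = 0 := by
    ext x
    rw [coe_L, hg hj, hker j hj, zero_apply]
  let fb : (ℕ → ℂ) → Entire := fun b => ∑ j ∈ Finset.range r, b j • g j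
  have hfb (b : ℕ → ℂ) : ⇑(fb b) = fun s => ∑ j ∈ Finset.range r, b j * f j s := by
    funext s
    rw [coe_sum_apply]
    exact Finset.sum_congr rfl fun j hj => by rw [smul_apply, hg (Finset.mem_range.1 hj)]
  have hLfb (b : ℕ → ℂ) : L r a (fb b) = 0 := by
    rw [map_sum]
    exact Finset.sum_eq_zero fun j hj => by
      rw [map_smul, hLg (Finset.mem_range.1 hj), smul_zero]
  have hbis (b : ℕ → ℂ) : Bispectral (fb b) Kbar Fo :=
    Bispectral.sum _ fun q _ => ((bispectral_X r a (hLfb b)).aeval _).mul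
      (((bispectral_D _).pow _).mul ((bispectral_L r a (hLfb b)).pow _))
  have hF (b : ℕ → ℂ) (x : ℂ) :
      Fop r n a K (fun t => ∑ l ∈ Finset.range m, ∑ j ∈ Finset.range (d + 1),
        A l j * iteratedDeriv j (fun s => ∑ j' ∈ Finset.range r, b j' * f j' s) (t + nu l)) x
        = (c ∘ₗ Kbar) (trans x (fb b)) := by
    obtain ⟨⟨Φ, -, hΦ⟩, -⟩ := id hc
    have e : (fun t => ∑ l ∈ Finset.range m, ∑ j ∈ Finset.range (d + 1),
        A l j * iteratedDeriv j (fun s => ∑ j' ∈ Finset.range r, b j' * f j' s) (t + nu l))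
        = Φ (fb b) := by
      funext t
      rw [hΦ, hc_apply, ← hfb]
      refine Finset.sum_congr rfl fun l _ => Finset.sum_congr rfl fun j _ => ?_
      exact congrArg _ (congrFun (iteratedDeriv_comp_const_add j (fb b) t) (nu l)).symm
    rw [e, hFop]
    exact ((hbis b) c hc).2 _ (hΦ _) x
  have hu : (∀ u : ℂ → ℂ, Differentiable ℂ u →
      ∑ l ∈ Finset.range m, ∑ j ∈ Finset.range (d + 1),
        A l j * iteratedDeriv j (wrDetB (r * n) (phiFam r n f lam gam) u) (nu l) = 0)
      ↔ c ∘ₗ Kbar = 0 := by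
    rw [LinearMap.ext_iff]
    refine ⟨fun h u => ?_, fun h u hu => ?_⟩
    · rw [LinearMap.comp_apply, hc_apply, ← hwr]
      exact h u (differentiable u)
    · have := h (mk u hu)
      rwa [LinearMap.comp_apply, hc_apply, ← hwr] at this
  rw [hu]
  simp only [hF]
  refine ⟨fun h => ?_, fun h b x => by rw [h, LinearMap.zero_apply]⟩
  have hfb0 : fb (Pi.single 0 1) = g 0 := by
    have h0 : 0 ∈ Finset.range r := Finset.mem_range.2 (by omega)
    simp [fb, Pi.single_apply, Finset.sum_ite_eq', h0]
  have hg0 : fb (Pi.single 0 1) ≠ 0 := by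
    rw [hfb0]
    intro h0
    have hf0 : f 0 = fun _ => 0 := by
      rw [← hg (by omega : 0 < r), h0]
      rfl
    have hw := hwrf 0
    rw [wrDet, Matrix.det_eq_zero_of_column_eq_zero (⟨0, by omega⟩ : Fin r)] at hw
    · exact zero_ne_one hw
    · intro k
      simp [hf0]
  exact eq_zero_of_trans (hLfb _) hg0 ((hbis (Pi.single 0 1)) c hc).1 (h _)
end

section
/- If Q ∈ 𝒟 commutes with L₀, then Q is a polynomial in L₀ with complex coefficients; that is, there exists p ∈ ℂ[t] with Q = p(L₀). In other words, the centralizer of the generalized Airy operator L₀ in the ring 𝒟 of ordinary differential operators with rational function coefficients is exactly ℂ[L₀]; in particular L₀ has true rank r. -/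
open scoped BigOperators

/-- The derivation `∂`, regarded as a `ℂ`-linear endomorphism of `ℂ(x)`. -/
noncomputable def delOp (D : Derivation ℂ (RatFunc ℂ) (RatFunc ℂ)) :
    Module.End ℂ (RatFunc ℂ) :=
  D.toLinearMap

/-- Multiplication by a rational function, as a `ℂ`-linear endomorphism of `ℂ(x)`. -/
noncomputable def mulOp (h : RatFunc ℂ) : Module.End ℂ (RatFunc ℂ) :=
  LinearMap.mulLeft ℂ h

/-- The ring `𝒟` of ordinary differential operators with rational function
coefficients: the subalgebra of `End_ℂ(ℂ(x))` generated by `∂` and all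
multiplication operators. -/
noncomputable def Dalg (D : Derivation ℂ (RatFunc ℂ) (RatFunc ℂ)) :
    Subalgebra ℂ (Module.End ℂ (RatFunc ℂ)) :=
  Algebra.adjoin ℂ ({delOp D} ∪ Set.range mulOp)

/-- `T` can be written as `∑_{k ≤ d} M_{h_k} ∘ ∂^k`. -/
def hasOrdAtMost (D : Derivation ℂ (RatFunc ℂ) (RatFunc ℂ))
    (T : Module.End ℂ (RatFunc ℂ)) (d : ℕ) : Prop :=
  ∃ h : ℕ → RatFunc ℂ, T = ∑ k ∈ Finset.range (d + 1), mulOp (h k) * delOp D ^ k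

/-- The order of an ordinary differential operator: the least `d` such that
`T = ∑_{k ≤ d} M_{h_k} ∘ ∂^k`. -/
noncomputable def ordOf (D : Derivation ℂ (RatFunc ℂ) (RatFunc ℂ))
    (T : Module.End ℂ (RatFunc ℂ)) : ℕ :=
  sInf {d | hasOrdAtMost D T d}

/-- The generalized Airy operator `L₀ = ∂^r - ∑_{k=1}^{r-2} a_k ∂^k - M_x` in `𝒟`. -/
noncomputable def airyEnd (D : Derivation ℂ (RatFunc ℂ) (RatFunc ℂ))
    (r : ℕ) (a : ℕ → ℂ) : Module.End ℂ (RatFunc ℂ) :=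
  delOp D ^ r - (∑ k ∈ Finset.Ico 1 (r - 1), a k • delOp D ^ k) - mulOp RatFunc.X

section OrderFiltration

variable {A : Type*} [Ring A] [Algebra ℂ A]

/-- The elements of `A` of the form `∑_{k < n} s_k * d ^ k` with coefficients `s_k ∈ S`. -/
noncomputable def ordFilt (S : Subalgebra ℂ A) (d : A) : ℕ → Submodule ℂ A
  | 0 => ⊥
  | n + 1 => ordFilt S d n ⊔ S.toSubmodule.map (LinearMap.mulRight ℂ (d ^ n))

variable {S : Subalgebra ℂ A} {d u : A}

theorem mem_ordFilt_succ {n : ℕ} {T : A} :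
    T ∈ ordFilt S d (n + 1) ↔ ∃ f ∈ ordFilt S d n, ∃ s ∈ S, f + s * d ^ n = T := by
  simp [ordFilt, Submodule.mem_sup]

theorem ordFilt_mono : Monotone (ordFilt S d) :=
  monotone_nat_of_le_succ fun _ => le_sup_left

theorem mul_pow_mem_ordFilt {s : A} (hs : s ∈ S) {k n : ℕ} (h : k < n) :
    s * d ^ k ∈ ordFilt S d n :=
  ordFilt_mono h (mem_ordFilt_succ.2 ⟨0, zero_mem _, s, hs, zero_add _⟩)

theorem pow_mem_ordFilt {k n : ℕ} (h : k < n) : d ^ k ∈ ordFilt S d n := by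
  simpa using mul_pow_mem_ordFilt (d := d) (one_mem S) h

/-- To prove that a linear map sends `ordFilt S d n` into a submodule, it suffices to consider
monomials. -/
theorem map_mem_of_mem_ordFilt {B : Type*} [AddCommGroup B] [Module ℂ B] (φ : A →ₗ[ℂ] B)
    (N : Submodule ℂ B) {n : ℕ} (h : ∀ s ∈ S, ∀ k < n, φ (s * d ^ k) ∈ N) {T : A}
    (hT : T ∈ ordFilt S d n) : φ T ∈ N := by
  induction n generalizing T with
  | zero =>
    have : T = 0 := by simpa [ordFilt] using hT
    simp [this]
  | succ n ih =>
    obtain ⟨f, hf, s, hs, rfl⟩ := mem_ordFilt_succ.1 hT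
    rw [map_add]
    exact add_mem (ih (fun s hs k hk => h s hs k (by omega)) hf) (h s hs n (by omega))

theorem mul_pow_mem_ordFilt_add {n : ℕ} {T : A} (hT : T ∈ ordFilt S d n) (m : ℕ) :
    T * d ^ m ∈ ordFilt S d (n + m) := by
  refine map_mem_of_mem_ordFilt (LinearMap.mulRight ℂ (d ^ m)) _ (fun s hs k hk => ?_) hT
  rw [LinearMap.mulRight_apply, mul_assoc, ← pow_add]
  exact mul_pow_mem_ordFilt hs (by omega)

theorem coeff_mul_mem_ordFilt {n : ℕ} {s T : A} (hs : s ∈ S) (hT : T ∈ ordFilt S d n) :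
    s * T ∈ ordFilt S d n := by
  refine map_mem_of_mem_ordFilt (LinearMap.mulLeft ℂ s) _ (fun t ht k hk => ?_) hT
  rw [LinearMap.mulLeft_apply, ← mul_assoc]
  exact mul_pow_mem_ordFilt (mul_mem hs ht) hk

theorem gen_mul_mem_ordFilt (hd : ∀ s ∈ S, d * s - s * d ∈ S) {n : ℕ} {T : A}
    (hT : T ∈ ordFilt S d n) : d * T ∈ ordFilt S d (n + 1) := by
  refine map_mem_of_mem_ordFilt (LinearMap.mulLeft ℂ d) _ (fun s hs k hk => ?_) hT
  have : d * (s * d ^ k) = (d * s - s * d) * d ^ k + s * d ^ (k + 1) := by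
    rw [pow_succ']; noncomm_ring
  rw [LinearMap.mulLeft_apply, this]
  exact add_mem (mul_pow_mem_ordFilt (hd s hs) (by omega)) (mul_pow_mem_ordFilt hs (by omega))

theorem pow_mul_mem_ordFilt (hd : ∀ s ∈ S, d * s - s * d ∈ S) {n : ℕ} {T : A}
    (hT : T ∈ ordFilt S d n) (m : ℕ) : d ^ m * T ∈ ordFilt S d (n + m) := by
  induction m with
  | zero => simpa using hT
  | succ m ih =>
    rw [pow_succ', mul_assoc]
    exact gen_mul_mem_ordFilt hd ih

theorem mul_mem_ordFilt (hd : ∀ s ∈ S, d * s - s * d ∈ S) {m n : ℕ} {T U : A}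
    (hT : T ∈ ordFilt S d m) (hU : U ∈ ordFilt S d n) : T * U ∈ ordFilt S d (m + n) := by
  refine map_mem_of_mem_ordFilt (LinearMap.mulRight ℂ U) _ (fun s hs k hk => ?_) hT
  rw [LinearMap.mulRight_apply, mul_assoc]
  exact coeff_mul_mem_ordFilt hs (ordFilt_mono (by omega) (pow_mul_mem_ordFilt hd hU k))

theorem exists_mem_ordFilt_of_mem_adjoin (hd : ∀ s ∈ S, d * s - s * d ∈ S) {T : A}
    (hT : T ∈ Algebra.adjoin ℂ (insert d (S : Set A))) : ∃ n, T ∈ ordFilt S d n := by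
  have hS : ∀ s ∈ S, ∃ n, s ∈ ordFilt S d n := fun s hs =>
    ⟨1, by simpa using mul_pow_mem_ordFilt (d := d) hs zero_lt_one⟩
  induction hT using Algebra.adjoin_induction with
  | mem T hT =>
    rcases hT with rfl | hT
    · exact ⟨2, by simpa using pow_mem_ordFilt (S := S) (d := T) one_lt_two⟩
    · exact hS T hT
  | algebraMap c => exact hS _ (S.algebraMap_mem c)
  | add T U _ _ hT hU =>
    obtain ⟨m, hm⟩ := hT
    obtain ⟨n, hn⟩ := hU
    exact ⟨max m n, add_mem (ordFilt_mono (le_max_left _ _) hm)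
      (ordFilt_mono (le_max_right _ _) hn)⟩
  | mul T U _ _ hT hU =>
    obtain ⟨m, hm⟩ := hT
    obtain ⟨n, hn⟩ := hU
    exact ⟨m + n, mul_mem_ordFilt hd hm hn⟩

/-- `d ^ (i + 1) * s` agrees with `s * d ^ (i + 1) + (i + 1) * [d, s] * d ^ i` up to terms of
order less than `i`. -/
theorem pow_succ_mul_sub_mem_ordFilt (hd : ∀ s ∈ S, d * s - s * d ∈ S) {s : A} (hs : s ∈ S)
    (i : ℕ) : d ^ (i + 1) * s - s * d ^ (i + 1) - (i + 1 : ℂ) • ((d * s - s * d) * d ^ i)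
      ∈ ordFilt S d i := by
  induction i with
  | zero => simp
  | succ i ih =>
    set s' := d * s - s * d with hs'
    have h1 := gen_mul_mem_ordFilt hd ih
    have h2 : (i + 1 : ℂ) • ((d * s' - s' * d) * d ^ i) ∈ ordFilt S d (i + 1) :=
      Submodule.smul_mem _ _ (mul_pow_mem_ordFilt (hd _ (hd s hs)) (by omega))
    convert add_mem h1 h2 using 1
    push_cast
    have e1 : d ^ (i + 1 + 1) * s = d * (d ^ (i + 1) * s) := by rw [pow_succ' d (i + 1), mul_assoc]
    have e2 : s * d ^ (i + 1 + 1) = d * (s * d ^ (i + 1)) - s' * d ^ (i + 1) := by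
      rw [hs', pow_succ' d (i + 1)]; noncomm_ring
    have e3 : (d * s' - s' * d) * d ^ i = d * (s' * d ^ i) - s' * d ^ (i + 1) := by
      rw [pow_succ' d i]; noncomm_ring
    rw [e1, e2, e3]
    simp only [mul_sub, smul_sub, add_smul, one_smul, mul_add, mul_smul_comm]
    abel

theorem pow_mul_sub_mem_ordFilt (hd : ∀ s ∈ S, d * s - s * d ∈ S) {s : A} (hs : s ∈ S)
    (i : ℕ) : d ^ i * s - s * d ^ i ∈ ordFilt S d i := by
  cases i with
  | zero => simp
  | succ i =>
    have h1 := ordFilt_mono (Nat.le_succ i) (pow_succ_mul_sub_mem_ordFilt hd hs i)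
    have h2 : (i + 1 : ℂ) • ((d * s - s * d) * d ^ i) ∈ ordFilt S d (i + 1) :=
      Submodule.smul_mem _ _ (mul_pow_mem_ordFilt (hd _ hs) (by omega))
    simpa using add_mem h1 h2

/-- The inner derivation `T ↦ u * T - T * u`. -/
noncomputable def innerAd (u : A) : A →ₗ[ℂ] A := LinearMap.mulLeft ℂ u - LinearMap.mulRight ℂ u

theorem innerAd_apply (u T : A) : innerAd u T = u * T - T * u := rfl

theorem innerAd_mul_pow (hud : u * d - d * u = 1) {s : A} (hs : u * s = s * u) (k : ℕ) :
    innerAd u (s * d ^ (k + 1)) = (k + 1 : ℂ) • (s * d ^ k) := by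
  have key : ∀ k : ℕ, u * d ^ (k + 1) - d ^ (k + 1) * u = (k + 1 : ℂ) • d ^ k := by
    intro k
    induction k with
    | zero => simpa using hud
    | succ k ih =>
      have : u * d ^ (k + 1 + 1) - d ^ (k + 1 + 1) * u
          = (u * d ^ (k + 1) - d ^ (k + 1) * u) * d + d ^ (k + 1) * (u * d - d * u) := by
        rw [pow_succ d (k + 1)]; noncomm_ring
      rw [this, ih, hud, smul_mul_assoc, ← pow_succ]
      push_cast
      simp only [add_smul, one_smul, mul_one]
  rw [innerAd_apply, ← mul_assoc, hs, mul_assoc, mul_assoc, ← mul_sub, key, mul_smul_comm]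

theorem innerAd_mem_ordFilt (hud : u * d - d * u = 1) (hS : ∀ s ∈ S, u * s = s * u) {n : ℕ}
    {T : A} (hT : T ∈ ordFilt S d (n + 1)) : innerAd u T ∈ ordFilt S d n := by
  refine map_mem_of_mem_ordFilt _ _ (fun s hs k hk => ?_) hT
  cases k with
  | zero => simp [innerAd_apply, hS s hs]
  | succ k =>
    rw [innerAd_mul_pow hud (hS s hs)]
    exact Submodule.smul_mem _ _ (mul_pow_mem_ordFilt hs (by omega))

theorem innerAd_pow_eq_zero (hud : u * d - d * u = 1) (hS : ∀ s ∈ S, u * s = s * u) {n : ℕ}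
    {T : A} (hT : T ∈ ordFilt S d n) : (innerAd u ^ n) T = 0 := by
  induction n generalizing T with
  | zero => simpa [ordFilt] using hT
  | succ n ih =>
    rw [pow_succ, Module.End.mul_apply]
    exact ih (innerAd_mem_ordFilt hud hS hT)

theorem innerAd_pow_mul_pow (hud : u * d - d * u = 1) {s : A} (hs : u * s = s * u) (n : ℕ) :
    (innerAd u ^ n) (s * d ^ n) = (n.factorial : ℂ) • s := by
  induction n with
  | zero => simp
  | succ n ih =>
    rw [pow_succ, Module.End.mul_apply, innerAd_mul_pow hud hs, map_smul, ih, smul_smul,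
      Nat.factorial_succ]
    push_cast
    rfl

theorem coeff_eq_zero_of_mem_ordFilt (hud : u * d - d * u = 1) (hS : ∀ s ∈ S, u * s = s * u)
    {n : ℕ} {s : A} (hs : s ∈ S) (h : s * d ^ n ∈ ordFilt S d n) : s = 0 := by
  have h1 := innerAd_pow_eq_zero hud hS h
  rw [innerAd_pow_mul_pow hud (hS s hs)] at h1
  exact (smul_eq_zero.1 h1).resolve_left (by exact_mod_cast n.factorial_ne_zero)

theorem mem_of_mem_ordFilt_of_commute (hud : u * d - d * u = 1) (hS : ∀ s ∈ S, u * s = s * u)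
    {n : ℕ} {T : A} (hT : T ∈ ordFilt S d n) (hc : u * T = T * u) : T ∈ S := by
  induction n with
  | zero =>
    have : T = 0 := by simpa [ordFilt] using hT
    simp [this]
  | succ n ih =>
    obtain ⟨f, hf, s, hs, rfl⟩ := mem_ordFilt_succ.1 hT
    cases n with
    | zero =>
      have : f = 0 := by simpa [ordFilt] using hf
      simpa [this] using hs
    | succ n =>
      have h0 : (innerAd u ^ (n + 1)) (f + s * d ^ (n + 1)) = 0 := by
        rw [pow_succ, Module.End.mul_apply, innerAd_apply, hc, sub_self, map_zero]
      rw [map_add, innerAd_pow_eq_zero hud hS hf, zero_add,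
        innerAd_pow_mul_pow hud (hS s hs)] at h0
      have hs0 : s = 0 :=
        (smul_eq_zero.1 h0).resolve_left (by exact_mod_cast (n + 1).factorial_ne_zero)
      apply ih
      simpa [hs0] using hf

end OrderFiltration

section RationalFunctions

variable {D : Derivation ℂ (RatFunc ℂ) (RatFunc ℂ)}

theorem exists_derivative_eq (p : Polynomial ℂ) : ∃ q, Polynomial.derivative q = p := by
  induction p using Polynomial.induction_on' with
  | add p q hp hq =>
    obtain ⟨f, rfl⟩ := hp
    obtain ⟨g, rfl⟩ := hq
    exact ⟨f + g, map_add _ _ _⟩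
  | monomial n c =>
    refine ⟨Polynomial.monomial (n + 1) (c / (n + 1)), ?_⟩
    have : (n : ℂ) + 1 ≠ 0 := by exact_mod_cast n.succ_ne_zero
    rw [Polynomial.derivative_monomial]
    simp [this]

theorem ratFunc_eq_algebraMap_of_derivation_eq_zero
    (hD : ∀ p : Polynomial ℂ, D (algebraMap (Polynomial ℂ) (RatFunc ℂ) p)
      = algebraMap (Polynomial ℂ) (RatFunc ℂ) (Polynomial.derivative p))
    {f : RatFunc ℂ} (hf : D f = 0) : ∃ p : Polynomial ℂ, algebraMap _ (RatFunc ℂ) p = f := by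
  have hden : algebraMap (Polynomial ℂ) (RatFunc ℂ) f.denom ≠ 0 := by
    simpa using f.denom_ne_zero
  have hnum : f * algebraMap (Polynomial ℂ) (RatFunc ℂ) f.denom
      = algebraMap (Polynomial ℂ) (RatFunc ℂ) f.num := by
    exact ((div_eq_iff hden).1 f.num_div_denom).symm
  have h1 := congrArg D hnum
  rw [D.leibniz, hf, hD, hD, smul_zero, add_zero, smul_eq_mul] at h1
  have h2 : f.num * Polynomial.derivative f.denom = Polynomial.derivative f.num * f.denom := by
    apply FaithfulSMul.algebraMap_injective (Polynomial ℂ) (RatFunc ℂ)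
    rw [map_mul, map_mul, ← hnum, ← h1]
    ring
  have h3 : f.denom ∣ Polynomial.derivative f.denom :=
    f.isCoprime_num_denom.symm.dvd_of_dvd_mul_left ⟨_, h2.trans (mul_comm _ _)⟩
  have h4 : f.denom = 1 := by
    by_contra hne
    have h5 : Polynomial.derivative f.denom = 0 := by
      by_contra h6
      exact absurd (Polynomial.degree_le_of_dvd h3 h6)
        (not_le.2 (Polynomial.degree_derivative_lt f.denom_ne_zero))
    exact hne ((Polynomial.Monic.natDegree_eq_zero f.monic_denom).1
      (Polynomial.derivative_eq_zero.1 h5))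
  exact ⟨f.num, by rw [← hnum, h4]; simp⟩

theorem ratFunc_eq_algebraMap_of_derivation_eq_algebraMap
    (hD : ∀ p : Polynomial ℂ, D (algebraMap (Polynomial ℂ) (RatFunc ℂ) p)
      = algebraMap (Polynomial ℂ) (RatFunc ℂ) (Polynomial.derivative p))
    {f : RatFunc ℂ} {p : Polynomial ℂ} (hf : D f = algebraMap _ (RatFunc ℂ) p) :
    ∃ q : Polynomial ℂ, algebraMap _ (RatFunc ℂ) q = f := by
  obtain ⟨q, rfl⟩ := exists_derivative_eq p
  obtain ⟨g, hg⟩ := ratFunc_eq_algebraMap_of_derivation_eq_zero hD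
    (f := f - algebraMap _ (RatFunc ℂ) q) (by rw [map_sub, hf, hD, sub_self])
  exact ⟨g + q, by rw [map_add, hg]; ring⟩

end RationalFunctions

section DifferentialOperators

variable (D : Derivation ℂ (RatFunc ℂ) (RatFunc ℂ))

/-- The subalgebra of multiplication operators. -/
noncomputable def mulOps : Subalgebra ℂ (Module.End ℂ (RatFunc ℂ)) :=
  (Algebra.lmul ℂ (RatFunc ℂ)).range

theorem mulOp_mem (h : RatFunc ℂ) : mulOp h ∈ mulOps := ⟨h, rfl⟩

theorem mulOp_apply (h f : RatFunc ℂ) : mulOp h f = h * f := rfl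

theorem delOp_mul_mulOp (h : RatFunc ℂ) :
    delOp D * mulOp h - mulOp h * delOp D = mulOp (D h) := by
  ext f
  simp [delOp, mulOp, D.leibniz, mul_comm]

theorem delOp_comm_mem : ∀ s ∈ mulOps, delOp D * s - s * delOp D ∈ mulOps := by
  rintro _ ⟨h, rfl⟩
  exact ⟨D h, (delOp_mul_mulOp D h).symm⟩

theorem mem_ordFilt_mulOps_iff {T : Module.End ℂ (RatFunc ℂ)} {n : ℕ} :
    T ∈ ordFilt mulOps (delOp D) (n + 1) ↔ hasOrdAtMost D T n := by
  constructor
  · intro hT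
    suffices H : ∀ n, ∀ T ∈ ordFilt mulOps (delOp D) n, ∃ h : ℕ → RatFunc ℂ,
        T = ∑ k ∈ Finset.range n, mulOp (h k) * delOp D ^ k from H _ _ hT
    intro n
    induction n with
    | zero => intro T hT; exact ⟨0, by simpa [ordFilt] using hT⟩
    | succ n ih =>
      intro T hT
      obtain ⟨f, hf, _, ⟨g, rfl⟩, rfl⟩ := mem_ordFilt_succ.1 hT
      obtain ⟨h, rfl⟩ := ih f hf
      refine ⟨Function.update h n g, ?_⟩
      rw [Finset.sum_range_succ, Function.update_self]
      congr 1
      refine Finset.sum_congr rfl fun k hk => ?_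
      rw [Function.update_of_ne (Finset.mem_range.1 hk).ne]
  · rintro ⟨h, rfl⟩
    exact sum_mem fun k hk => mul_pow_mem_ordFilt (mulOp_mem _) (Finset.mem_range.1 hk)

variable {D} (hD : ∀ p : Polynomial ℂ, D (algebraMap (Polynomial ℂ) (RatFunc ℂ) p)
      = algebraMap (Polynomial ℂ) (RatFunc ℂ) (Polynomial.derivative p))

theorem mulOp_commute (h : RatFunc ℂ) : ∀ s ∈ mulOps, -mulOp h * s = s * -mulOp h := by
  rintro _ ⟨g, rfl⟩
  ext f
  simp [mulOp]
  ring

section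

include hD

theorem delOp_mul_mulOp_X : delOp D * mulOp RatFunc.X - mulOp RatFunc.X * delOp D = 1 := by
  have hX : D RatFunc.X = 1 := by
    rw [← RatFunc.algebraMap_X, hD, Polynomial.derivative_X, map_one]
  rw [delOp_mul_mulOp, hX]
  ext f
  simp [mulOp]

theorem neg_mulOp_X_commutator :
    -mulOp RatFunc.X * delOp D - delOp D * -mulOp RatFunc.X = 1 := by
  rw [← delOp_mul_mulOp_X hD]
  noncomm_ring

theorem ordOf_eq_of_sub_mem {T : Module.End ℂ (RatFunc ℂ)} {n : ℕ} {c : ℂ} (hc : c ≠ 0)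
    (hT : T - c • delOp D ^ n ∈ ordFilt mulOps (delOp D) n) : ordOf D T = n := by
  have hcm : algebraMap ℂ (Module.End ℂ (RatFunc ℂ)) c ∈ mulOps := mulOps.algebraMap_mem c
  have hmem : hasOrdAtMost D T n := by
    rw [← mem_ordFilt_mulOps_iff, mem_ordFilt_succ]
    exact ⟨_, hT, _, hcm, by rw [← Algebra.smul_def, sub_add_cancel]⟩
  refine le_antisymm (Nat.sInf_le hmem) (le_csInf ⟨n, hmem⟩ fun m hm => ?_)
  by_contra! hlt
  have h1 := ordFilt_mono (Nat.succ_le_of_lt hlt) (mem_ordFilt_mulOps_iff D |>.2 hm)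
  have h2 : algebraMap ℂ (Module.End ℂ (RatFunc ℂ)) c * delOp D ^ n
      ∈ ordFilt mulOps (delOp D) n := by
    rw [← Algebra.smul_def]
    simpa using sub_mem h1 hT
  have h3 := coeff_eq_zero_of_mem_ordFilt (neg_mulOp_X_commutator hD) (mulOp_commute _) hcm h2
  have h4 := congrArg (fun T : Module.End ℂ (RatFunc ℂ) => T 1) h3
  exact hc (by simpa [Module.algebraMap_end_apply] using h4)

end

variable (D) in
theorem airyEnd_sub_pow_mem {r : ℕ} (hr : 2 ≤ r) (a : ℕ → ℂ) :
    airyEnd D r a - delOp D ^ r ∈ ordFilt mulOps (delOp D) r := by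
  have h1 : ∑ k ∈ Finset.Ico 1 (r - 1), a k • delOp D ^ k ∈ ordFilt mulOps (delOp D) r :=
    sum_mem fun k hk => Submodule.smul_mem _ _
      (pow_mem_ordFilt (by have := Finset.mem_Ico.1 hk; omega))
  have h2 : mulOp RatFunc.X ∈ ordFilt mulOps (delOp D) r := by
    simpa using mul_pow_mem_ordFilt (d := delOp D) (mulOp_mem RatFunc.X) (k := 0) (by omega : 0 < r)
  convert neg_mem (add_mem h1 h2) using 1
  rw [airyEnd]
  abel

variable (D) in
theorem airyEnd_pow_sub_pow_mem {r : ℕ} (hr : 2 ≤ r) (a : ℕ → ℂ) (k : ℕ) :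
    airyEnd D r a ^ k - delOp D ^ (r * k) ∈ ordFilt mulOps (delOp D) (r * k) := by
  induction k with
  | zero => simp
  | succ k ih =>
    set L := airyEnd D r a
    have hL := airyEnd_sub_pow_mem D hr a
    have h1 := pow_mul_mem_ordFilt (delOp_comm_mem D) hL (r * k)
    have h2 := mul_pow_mem_ordFilt_add ih r
    have h3 := mul_mem_ordFilt (delOp_comm_mem D) ih hL
    rw [Nat.add_comm] at h1
    rw [mul_add, mul_one, pow_add (delOp D), pow_succ]
    convert add_mem (add_mem h1 h2) h3 using 1
    noncomm_ring

variable (D) in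
theorem aeval_airyEnd_sub_mem {r : ℕ} (hr : 2 ≤ r) (a : ℕ → ℂ) (p : Polynomial ℂ) :
    Polynomial.aeval (airyEnd D r a) p - p.leadingCoeff • delOp D ^ (r * p.natDegree)
      ∈ ordFilt mulOps (delOp D) (r * p.natDegree) := by
  rw [Polynomial.aeval_eq_sum_range, Finset.sum_range_succ, add_sub_assoc, Polynomial.leadingCoeff,
    ← smul_sub]
  refine add_mem (sum_mem fun k hk => Submodule.smul_mem _ _ ?_)
    (Submodule.smul_mem _ _ (airyEnd_pow_sub_pow_mem D hr a _))
  have hlt : r * k < r * p.natDegree :=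
    Nat.mul_lt_mul_of_pos_left (Finset.mem_range.1 hk) (by omega)
  have := add_mem (ordFilt_mono hlt.le (airyEnd_pow_sub_pow_mem D hr a k))
    (pow_mem_ordFilt (S := mulOps) (d := delOp D) hlt)
  simpa using this

include hD in
/-- The top order part of the commutator of `L₀` with a monomial `h ∂ ^ m`. -/
theorem airyEnd_commutator_monomial {s : ℕ} (a : ℕ → ℂ) (h : RatFunc ℂ) (m : ℕ) :
    innerAd (airyEnd D (s + 1) a) (mulOp h * delOp D ^ m)
        - mulOp ((s + 1 : ℂ) • D h) * delOp D ^ (m + s)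
      ∈ ordFilt mulOps (delOp D) (m + s) := by
  set d := delOp D with hd
  set H := mulOp h with hH
  have hHm : H ∈ mulOps := mulOp_mem h
  have h1 := mul_pow_mem_ordFilt_add (pow_succ_mul_sub_mem_ordFilt (delOp_comm_mem D) hHm s) m
  have h2 : ∑ k ∈ Finset.Ico 1 s, a k • ((d ^ k * H - H * d ^ k) * d ^ m)
      ∈ ordFilt mulOps d (s + m) := by
    refine sum_mem fun k hk => Submodule.smul_mem _ _ (ordFilt_mono ?_
      (mul_pow_mem_ordFilt_add (pow_mul_sub_mem_ordFilt (delOp_comm_mem D) hHm k) m))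
    have := Finset.mem_Ico.1 hk
    omega
  have h3 : innerAd (-mulOp RatFunc.X) (H * d ^ m) ∈ ordFilt mulOps d (s + m) :=
    ordFilt_mono (by omega) (innerAd_mem_ordFilt (neg_mulOp_X_commutator hD) (mulOp_commute _)
      (mul_pow_mem_ordFilt hHm (Nat.lt_succ_self m)))
  rw [add_comm m s]
  convert add_mem (sub_mem h1 h2) h3 using 1
  have e : mulOp ((s + 1 : ℂ) • D h) = (s + 1 : ℂ) • (d * H - H * d) := by
    rw [hd, hH, delOp_mul_mulOp]
    exact map_smul (LinearMap.mul ℂ (RatFunc ℂ)) _ _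
  have e2 : ∀ k, (d ^ k * H - H * d ^ k) * d ^ m
      = d ^ k * (H * d ^ m) - H * d ^ m * d ^ k := by
    intro k
    rw [mul_assoc H (d ^ m), ← pow_add, add_comm m k, pow_add]
    noncomm_ring
  rw [e, innerAd_apply, innerAd_apply, airyEnd, ← hd, Nat.add_sub_cancel, pow_add d s m]
  simp only [e2, smul_sub, Finset.sum_sub_distrib, sub_mul _ _ (d ^ m), mul_sub, sub_mul,
    Finset.sum_mul, Finset.mul_sum, smul_mul_assoc, mul_smul_comm]
  simp only [mul_assoc, neg_mul, mul_neg]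
  abel

include hD in
theorem innerAd_airyEnd_mem_ordFilt {s : ℕ} (a : ℕ → ℂ) {m : ℕ} {T : Module.End ℂ (RatFunc ℂ)}
    (hT : T ∈ ordFilt mulOps (delOp D) m) :
    innerAd (airyEnd D (s + 1) a) T ∈ ordFilt mulOps (delOp D) (m + s) := by
  refine map_mem_of_mem_ordFilt _ _ ?_ hT
  rintro _ ⟨h, rfl⟩ k hk
  have h1 := ordFilt_mono (by omega : k + s ≤ m + s)
    (airyEnd_commutator_monomial (s := s) hD a h k)
  have h2 := mul_pow_mem_ordFilt (d := delOp D) (mulOp_mem ((s + 1 : ℂ) • D h))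
    (by omega : k + s < m + s)
  have := add_mem h1 h2
  rwa [sub_add_cancel] at this

variable (D) in
/-- The Weyl algebra of differential operators with polynomial coefficients. -/
noncomputable def weylAlg : Subalgebra ℂ (Module.End ℂ (RatFunc ℂ)) :=
  Algebra.adjoin ℂ {delOp D, mulOp RatFunc.X}

variable (D) in
theorem delOp_mem_weylAlg : delOp D ∈ weylAlg D := Algebra.subset_adjoin (by simp)

variable (D) in
theorem mulOp_X_mem_weylAlg : mulOp RatFunc.X ∈ weylAlg D := Algebra.subset_adjoin (by simp)

variable (D) in
theorem airyEnd_mem_weylAlg (r : ℕ) (a : ℕ → ℂ) : airyEnd D r a ∈ weylAlg D :=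
  sub_mem (sub_mem (pow_mem (delOp_mem_weylAlg D) _)
    (sum_mem fun _ _ => Subalgebra.smul_mem _ (pow_mem (delOp_mem_weylAlg D) _) _))
    (mulOp_X_mem_weylAlg D)

variable (D) in
theorem mulOp_algebraMap_mem_weylAlg (p : Polynomial ℂ) :
    mulOp (algebraMap _ (RatFunc ℂ) p) ∈ weylAlg D := by
  have h : mulOp (algebraMap _ (RatFunc ℂ) p) = Polynomial.aeval (mulOp RatFunc.X) p := by
    have h1 : algebraMap _ (RatFunc ℂ) p = Polynomial.aeval RatFunc.X p := by
      rw [← RatFunc.algebraMap_X, Polynomial.aeval_algebraMap_apply, Polynomial.aeval_X_left_apply]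
    rw [h1]
    exact (Polynomial.aeval_algHom_apply (Algebra.lmul ℂ (RatFunc ℂ)) RatFunc.X p).symm
  rw [h]
  exact Algebra.adjoin_le (by simpa using mulOp_X_mem_weylAlg D)
    (Polynomial.aeval_mem_adjoin_singleton ℂ _)

include hD in
theorem weylAlg_map_polynomial {T : Module.End ℂ (RatFunc ℂ)} (hT : T ∈ weylAlg D)
    (p : Polynomial ℂ) :
    ∃ q : Polynomial ℂ, T (algebraMap _ (RatFunc ℂ) p) = algebraMap _ (RatFunc ℂ) q := by
  induction hT using Algebra.adjoin_induction generalizing p with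
  | mem T hT =>
    rcases hT with rfl | rfl
    · exact ⟨_, hD p⟩
    · exact ⟨Polynomial.X * p, by rw [map_mul, RatFunc.algebraMap_X, mulOp_apply]⟩
  | algebraMap c =>
    refine ⟨c • p, ?_⟩
    rw [Module.algebraMap_end_apply]
    exact (map_smul (IsScalarTower.toAlgHom ℂ (Polynomial ℂ) (RatFunc ℂ)) c p).symm
  | add T U _ _ hT hU =>
    obtain ⟨f, hf⟩ := hT p
    obtain ⟨g, hg⟩ := hU p
    exact ⟨f + g, by rw [LinearMap.add_apply, hf, hg, map_add]⟩
  | mul T U _ _ hT hU =>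
    obtain ⟨g, hg⟩ := hU p
    obtain ⟨f, hf⟩ := hT g
    exact ⟨f, by rw [Module.End.mul_apply, hg, hf]⟩

include hD in
/-- The leading coefficient of an operator in the Weyl algebra is a polynomial. -/
theorem leadingCoeff_polynomial_of_mem_weylAlg {T : Module.End ℂ (RatFunc ℂ)} (hT : T ∈ weylAlg D)
    {n : ℕ} {h : RatFunc ℂ} (hn : T - mulOp h * delOp D ^ n ∈ ordFilt mulOps (delOp D) n) :
    ∃ q : Polynomial ℂ, h = algebraMap _ (RatFunc ℂ) q := by
  have hmem : ∀ k, (innerAd (-mulOp RatFunc.X) ^ k) T ∈ weylAlg D := by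
    intro k
    induction k with
    | zero => exact hT
    | succ k ih =>
      have hX := neg_mem (mulOp_X_mem_weylAlg D)
      rw [pow_succ', Module.End.mul_apply, innerAd_apply]
      exact sub_mem (mul_mem hX ih) (mul_mem ih hX)
  have h0 := innerAd_pow_eq_zero (neg_mulOp_X_commutator hD) (mulOp_commute _) hn
  rw [map_sub, innerAd_pow_mul_pow (neg_mulOp_X_commutator hD)
    (mulOp_commute _ _ (mulOp_mem h)), sub_eq_zero] at h0
  have hf : (n.factorial : ℂ) ≠ 0 := by exact_mod_cast n.factorial_ne_zero
  have h1 : mulOp h ∈ weylAlg D := by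
    have := Subalgebra.smul_mem _ (hmem n) (n.factorial : ℂ)⁻¹
    rwa [h0, inv_smul_smul₀ hf] at this
  obtain ⟨q, hq⟩ := weylAlg_map_polynomial hD h1 1
  exact ⟨q, by rw [← hq, map_one, mulOp_apply, mul_one]⟩

include hD in
theorem mem_weylAlg_of_innerAd_mem {s : ℕ} (a : ℕ → ℂ) {n : ℕ} {Q : Module.End ℂ (RatFunc ℂ)}
    (hQ : Q ∈ ordFilt mulOps (delOp D) n)
    (hc : innerAd (airyEnd D (s + 1) a) Q ∈ weylAlg D) : Q ∈ weylAlg D := by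
  induction n generalizing Q with
  | zero =>
    have : Q = 0 := by simpa [ordFilt] using hQ
    simp [this]
  | succ n ih =>
    obtain ⟨f, hf, _, ⟨h, rfl⟩, rfl⟩ := mem_ordFilt_succ.1 hQ
    change f + mulOp h * delOp D ^ n ∈ weylAlg D
    change innerAd _ (f + mulOp h * delOp D ^ n) ∈ weylAlg D at hc
    have hs : (s + 1 : ℂ) ≠ 0 := by exact_mod_cast s.succ_ne_zero
    obtain ⟨q, hq⟩ := leadingCoeff_polynomial_of_mem_weylAlg hD hc
      (n := n + s) (h := (s + 1 : ℂ) • D h) (by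
        rw [map_add, add_sub_assoc]
        exact add_mem (innerAd_airyEnd_mem_ordFilt hD a hf)
          (airyEnd_commutator_monomial hD a h n))
    have hh : D ((s + 1 : ℂ) • h) = algebraMap _ (RatFunc ℂ) q := by rw [D.map_smul, hq]
    obtain ⟨g, hg⟩ := ratFunc_eq_algebraMap_of_derivation_eq_algebraMap hD hh
    have hmem : mulOp h * delOp D ^ n ∈ weylAlg D := by
      refine mul_mem ?_ (pow_mem (delOp_mem_weylAlg D) n)
      have h1 := Subalgebra.smul_mem _ (mulOp_algebraMap_mem_weylAlg D g) (s + 1 : ℂ)⁻¹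
      rw [hg] at h1
      have h2 : mulOp ((s + 1 : ℂ) • h) = (s + 1 : ℂ) • mulOp h :=
        map_smul (LinearMap.mul ℂ (RatFunc ℂ)) _ _
      rwa [h2, inv_smul_smul₀ hs] at h1
    refine add_mem (ih hf ?_) hmem
    have hL := airyEnd_mem_weylAlg D (s + 1) a
    have h3 : innerAd (airyEnd D (s + 1) a) (mulOp h * delOp D ^ n) ∈ weylAlg D :=
      sub_mem (mul_mem hL hmem) (mul_mem hmem hL)
    simpa using sub_mem hc h3

include hD in
theorem airyEnd_commutator_delOp (r : ℕ) (a : ℕ → ℂ) :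
    airyEnd D r a * delOp D - delOp D * airyEnd D r a = 1 := by
  rw [← delOp_mul_mulOp_X hD, airyEnd]
  simp only [sub_mul, mul_sub, Finset.sum_mul, Finset.mul_sum, smul_mul_assoc, mul_smul_comm,
    ← pow_succ, ← pow_succ']
  abel

include hD in
theorem mem_adjoin_airyEnd_of_mem_weylAlg {r : ℕ} {a : ℕ → ℂ} {Q : Module.End ℂ (RatFunc ℂ)}
    (hQ : Q ∈ weylAlg D) (hc : airyEnd D r a * Q = Q * airyEnd D r a) :
    Q ∈ Algebra.adjoin ℂ {airyEnd D r a} := by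
  set L := airyEnd D r a with hL
  have hcomm := airyEnd_commutator_delOp hD r a
  have hS : ∀ s ∈ Algebra.adjoin ℂ {L}, L * s = s * L := fun s hs =>
    (Algebra.commute_of_mem_adjoin_self hs).eq
  have hd : ∀ s ∈ Algebra.adjoin ℂ {L}, delOp D * s - s * delOp D ∈ Algebra.adjoin ℂ {L} := by
    intro s hs
    induction hs using Algebra.adjoin_induction with
    | mem s hs =>
      obtain rfl : s = L := hs
      rw [← neg_sub, hcomm]
      exact neg_mem (one_mem _)
    | algebraMap c => simp [Algebra.commutes c (delOp D)]
    | add s t _ _ hs ht =>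
      convert add_mem hs ht using 1
      noncomm_ring
    | mul s t hs' ht' hs ht =>
      convert add_mem (mul_mem hs ht') (mul_mem hs' ht) using 1
      noncomm_ring
  have hle : weylAlg D ≤ Algebra.adjoin ℂ (insert (delOp D) (Algebra.adjoin ℂ {L} : Set _)) := by
    have h1 : delOp D ∈ Algebra.adjoin ℂ (insert (delOp D) (Algebra.adjoin ℂ {L} : Set _)) :=
      Algebra.subset_adjoin (Set.mem_insert _ _)
    have h2 : L ∈ Algebra.adjoin ℂ (insert (delOp D) (Algebra.adjoin ℂ {L} : Set _)) :=
      Algebra.subset_adjoin (Set.mem_insert_of_mem _ (Algebra.self_mem_adjoin_singleton ℂ L))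
    refine Algebra.adjoin_le ?_
    rintro _ (rfl | rfl)
    · exact h1
    · have e : mulOp RatFunc.X
          = delOp D ^ r - (∑ k ∈ Finset.Ico 1 (r - 1), a k • delOp D ^ k) - L := by
        rw [hL, airyEnd, sub_sub_cancel]
      rw [e]
      exact sub_mem (sub_mem (pow_mem h1 _)
        (sum_mem fun _ _ => Subalgebra.smul_mem _ (pow_mem h1 _) _)) h2
  obtain ⟨n, hn⟩ := exists_mem_ordFilt_of_mem_adjoin hd (hle hQ)
  exact mem_of_mem_ordFilt_of_commute hcomm hS hn hc

include hD in
theorem exists_aeval_airyEnd_eq {r : ℕ} (hr : 2 ≤ r) {a : ℕ → ℂ} {Q : Module.End ℂ (RatFunc ℂ)}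
    (hQ : Q ∈ Dalg D) (hc : Q * airyEnd D r a = airyEnd D r a * Q) :
    ∃ p : Polynomial ℂ, Q = Polynomial.aeval (airyEnd D r a) p := by
  obtain ⟨s, rfl⟩ : ∃ s, r = s + 1 := ⟨r - 1, by omega⟩
  have hQ' : Q ∈ Algebra.adjoin ℂ (insert (delOp D) (mulOps : Set _)) := hQ
  obtain ⟨n, hn⟩ := exists_mem_ordFilt_of_mem_adjoin (delOp_comm_mem D) hQ'
  have hW : Q ∈ weylAlg D := by
    refine mem_weylAlg_of_innerAd_mem (s := s) hD a hn ?_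
    rw [innerAd_apply, hc, sub_self]
    exact zero_mem _
  have := mem_adjoin_airyEnd_of_mem_weylAlg hD hW hc.symm
  rw [Algebra.adjoin_singleton_eq_range_aeval] at this
  obtain ⟨p, hp⟩ := this
  exact ⟨p, hp.symm⟩

end DifferentialOperators

theorem statement16 (r : ℕ) (hr : 2 ≤ r) (a : ℕ → ℂ)
    (D : Derivation ℂ (RatFunc ℂ) (RatFunc ℂ))
    (hD : ∀ p : Polynomial ℂ,
      D (algebraMap (Polynomial ℂ) (RatFunc ℂ) p)
        = algebraMap (Polynomial ℂ) (RatFunc ℂ) (Polynomial.derivative p)) :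
    (∀ Q ∈ Dalg D, Q * airyEnd D r a = airyEnd D r a * Q →
      ∃ p : Polynomial ℂ, Q = Polynomial.aeval (airyEnd D r a) p) ∧
    (∀ Q ∈ Dalg D, Q ≠ 0 → Q * airyEnd D r a = airyEnd D r a * Q → r ∣ ordOf D Q) ∧
    ordOf D (airyEnd D r a) = r := by
  have hord : ∀ p : Polynomial ℂ, p ≠ 0 →
      ordOf D (Polynomial.aeval (airyEnd D r a) p) = r * p.natDegree := fun p hp =>
    ordOf_eq_of_sub_mem hD (Polynomial.leadingCoeff_ne_zero.2 hp) (aeval_airyEnd_sub_mem D hr a p)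
  refine ⟨fun Q hQ hc => exists_aeval_airyEnd_eq hD hr hQ hc, fun Q hQ hne hc => ?_, ?_⟩
  · obtain ⟨p, rfl⟩ := exists_aeval_airyEnd_eq hD hr hQ hc
    rw [hord p (by rintro rfl; simp at hne)]
    exact dvd_mul_right _ _
  · simpa using hord Polynomial.X Polynomial.X_ne_zero
end
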